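/- Let n ≥ 2 and p ≥ 1, and let conjugacy classes C_1,…,C_{p+1} ⊂ GL(n,ℂ) be given, where C_1 has n distinct eigenvalues and det(B_1) ⋯ det(B_{p+1}) = 1. Then there exists a tuple (M_1,…,M_{p+1}) with M_j ∈ C_j, M_1 ⋯ M_{p+1} = I and trivial centralizer if and only if conditions (α_n) and (β_n) hold. -/

import Mathlib

open Polynomial BigOperators

noncomputable def rk {n : ℕ} (Y : Matrix (Fin n) (Fin n) ℂ) : ℕ :=
  ⨅ μ : ℂ, (Y - μ • (1 : Matrix (Fin n) (Fin n) ℂ)).rank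

/-- The submodule of matrices commuting with `Y`. -/
noncomputable def centSub {n : ℕ} (Y : Matrix (Fin n) (Fin n) ℂ) : Submodule ℂ (Matrix (Fin n) (Fin n) ℂ) where
  carrier := {Z | Y * Z = Z * Y}
  add_mem' := by
    intro a b ha hb
    simp only [Set.mem_setOf_eq] at *
    rw [Matrix.mul_add, Matrix.add_mul, ha, hb]
  zero_mem' := by simp
  smul_mem' := by
    intro c a ha
    simp only [Set.mem_setOf_eq] at *
    rw [Matrix.mul_smul, Matrix.smul_mul, ha]

/-- `d(Y) = n² - dim of centralizer of Y`, the dimension of the conjugacy class. -/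
noncomputable def dd {n : ℕ} (Y : Matrix (Fin n) (Fin n) ℂ) : ℕ :=
  n ^ 2 - Module.finrank ℂ (centSub Y)

def SameClass {n : ℕ} (A B : Matrix (Fin n) (Fin n) ℂ) : Prop :=
  ∃ S : Matrix (Fin n) (Fin n) ℂ, IsUnit S ∧ A = S * B * S⁻¹

def IrreducibleTuple {n q : ℕ} (A : Fin q → Matrix (Fin n) (Fin n) ℂ) : Prop :=
  ∀ W : Submodule ℂ (Fin n → ℂ), (∀ j, ∀ v ∈ W, (A j).mulVec v ∈ W) → W = ⊥ ∨ W = ⊤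

def TrivialCentralizer {n q : ℕ} (A : Fin q → Matrix (Fin n) (Fin n) ℂ) : Prop :=
  ∀ Z : Matrix (Fin n) (Fin n) ℂ, (∀ j, Z * A j = A j * Z) →
    ∃ c : ℂ, Z = c • (1 : Matrix (Fin n) (Fin n) ℂ)

def HasDistinctEigenvalues {n : ℕ} (Y : Matrix (Fin n) (Fin n) ℂ) : Prop :=
  ∃ μ : Fin n → ℂ, Function.Injective μ ∧ Y.charpoly = ∏ k, (Polynomial.X - Polynomial.C (μ k))

def IsDiagble {n : ℕ} (Y : Matrix (Fin n) (Fin n) ℂ) : Prop :=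
  ∃ S : Matrix (Fin n) (Fin n) ℂ, IsUnit S ∧ ∃ d : Fin n → ℂ, Y = S * Matrix.diagonal d * S⁻¹

noncomputable def multOf {n : ℕ} (Y : Matrix (Fin n) (Fin n) ℂ) (μ : ℂ) : ℕ :=
  Module.finrank ℂ (LinearMap.ker (Y - μ • (1 : Matrix (Fin n) (Fin n) ℂ)).mulVecLin)

/-- The Sylvester map `X ↦ P X - X R`. -/
noncomputable def sylv {l m : ℕ} (P : Matrix (Fin l) (Fin l) ℂ) (R : Matrix (Fin m) (Fin m) ℂ) :
    Matrix (Fin l) (Fin m) ℂ →ₗ[ℂ] Matrix (Fin l) (Fin m) ℂ where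
  toFun Z := P * Z - Z * R
  map_add' Z W := by
    show P * (Z + W) - (Z + W) * R = (P * Z - Z * R) + (P * W - W * R)
    rw [Matrix.mul_add, Matrix.add_mul]; abel
  map_smul' c Z := by
    show P * (c • Z) - (c • Z) * R = c • (P * Z - Z * R)
    rw [Matrix.mul_smul, Matrix.smul_mul, smul_sub]

noncomputable def sDim {l m : ℕ} (P : Matrix (Fin l) (Fin l) ℂ) (R : Matrix (Fin m) (Fin m) ℂ) : ℕ :=
  Module.finrank ℂ (LinearMap.range (sylv P R))

section own
open Matrix

set_option linter.unusedSectionVars false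
set_option linter.unusedSimpArgs false

section basics
variable {ι κ ν : Type} [Fintype ι] [DecidableEq ι] [Fintype κ] [DecidableEq κ] [Fintype ν] [DecidableEq ν]

def Sim (A : Matrix ι ι ℂ) (X : Matrix κ κ ℂ) : Prop :=
  ∃ (S : Matrix ι κ ℂ) (S' : Matrix κ ι ℂ), S * S' = 1 ∧ S' * S = 1 ∧ A = S * X * S'

noncomputable def gm (A : Matrix ι ι ℂ) (μ : ℂ) : ℕ :=
  Module.finrank ℂ (LinearMap.ker (A - μ • (1 : Matrix ι ι ℂ)).mulVecLin)

def Quad (A : Matrix ι ι ℂ) : Prop :=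
  ∃ β γ : ℂ, (A - β • (1 : Matrix ι ι ℂ)) * (A - γ • (1 : Matrix ι ι ℂ)) = 0

def Scal (A : Matrix ι ι ℂ) : Prop := ∃ β : ℂ, A = β • (1 : Matrix ι ι ℂ)

theorem Sim.refl (A : Matrix ι ι ℂ) : Sim A A := ⟨1, 1, by simp, by simp, by simp⟩

theorem Sim.symm {A : Matrix ι ι ℂ} {X : Matrix κ κ ℂ} (h : Sim A X) : Sim X A := by
  obtain ⟨S, S', h1, h2, h3⟩ := h
  refine ⟨S', S, h2, h1, ?_⟩
  rw [h3]
  calc X = (S' * S) * X * (S' * S) := by simp [h2]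
    _ = _ := by simp only [Matrix.mul_assoc]

theorem Sim.trans {A : Matrix ι ι ℂ} {X : Matrix κ κ ℂ} {Y : Matrix ν ν ℂ}
    (h : Sim A X) (h' : Sim X Y) : Sim A Y := by
  obtain ⟨S, S', h1, h2, h3⟩ := h
  obtain ⟨R, R', g1, g2, g3⟩ := h'
  refine ⟨S * R, R' * S', ?_, ?_, ?_⟩
  · calc S * R * (R' * S') = S * (R * R') * S' := by simp only [Matrix.mul_assoc]
      _ = 1 := by simp [g1, h1]
  · calc R' * S' * (S * R) = R' * (S' * S) * R := by simp only [Matrix.mul_assoc]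
      _ = 1 := by simp [g2, h2]
  · rw [h3, g3]; simp only [Matrix.mul_assoc]

theorem Sim.sub {A : Matrix ι ι ℂ} {X : Matrix κ κ ℂ} {S : Matrix ι κ ℂ} {S' : Matrix κ ι ℂ}
    (h1 : S * S' = 1) (h3 : A = S * X * S') (μ : ℂ) :
    A - μ • (1 : Matrix ι ι ℂ) = S * (X - μ • (1 : Matrix κ κ ℂ)) * S' := by
  rw [h3, Matrix.mul_sub, Matrix.sub_mul]; simp [h1]

theorem Sim.gm_le {A : Matrix ι ι ℂ} {X : Matrix κ κ ℂ} (h : Sim A X) (μ : ℂ) : gm X μ ≤ gm A μ := by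
  obtain ⟨S, S', h1, h2, h3⟩ := h
  unfold gm
  refine LinearMap.finrank_le_finrank_of_injective (f := S.mulVecLin.restrict
    (p := LinearMap.ker (X - μ • (1 : Matrix κ κ ℂ)).mulVecLin) ?_) ?_
  · intro v hv
    rw [LinearMap.mem_ker, Matrix.mulVecLin_apply] at hv ⊢
    rw [Sim.sub h1 h3, Matrix.mulVecLin_apply, Matrix.mulVec_mulVec, Matrix.mul_assoc, h2, Matrix.mul_one,
      ← Matrix.mulVec_mulVec, hv, Matrix.mulVec_zero]
  · intro v w hvw
    have := congrArg Subtype.val hvw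
    simp only [LinearMap.coe_restrict_apply, Matrix.mulVecLin_apply] at this
    have := congrArg (S'.mulVec) this
    rw [Matrix.mulVec_mulVec, Matrix.mulVec_mulVec, h2, Matrix.one_mulVec, Matrix.one_mulVec] at this
    exact Subtype.ext this

theorem Sim.gm_eq {A : Matrix ι ι ℂ} {X : Matrix κ κ ℂ} (h : Sim A X) (μ : ℂ) : gm A μ = gm X μ :=
  le_antisymm (h.symm.gm_le μ) (h.gm_le μ)

theorem Sim.det {A : Matrix ι ι ℂ} {X : Matrix κ κ ℂ} (h : Sim A X) : A.det = X.det := by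
  obtain ⟨S, S', h1, h2, h3⟩ := h
  rw [h3]; exact Matrix.det_conj_of_mul_eq_one h1 h2

theorem Sim.charpoly {A : Matrix ι ι ℂ} {X : Matrix κ κ ℂ} (h : Sim A X) : A.charpoly = X.charpoly := by
  obtain ⟨S, S', h1, h2, h3⟩ := h
  have e : A.charmatrix = S.map C * X.charmatrix * S'.map C := by
    have h1' : S.map C * S'.map C = (1 : Matrix ι ι ℂ[X]) := by
      rw [← Matrix.map_mul, h1]; simp
    rw [Matrix.charmatrix, Matrix.charmatrix, Matrix.mul_sub, Matrix.sub_mul, h3]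
    congr 1
    · rw [Matrix.scalar_apply, Matrix.scalar_apply, ← Matrix.smul_one_eq_diagonal, ← Matrix.smul_one_eq_diagonal]
      simp [h1']
    · simp [Matrix.map_mul, RingHom.mapMatrix_apply]
  rw [Matrix.charpoly, e, Matrix.charpoly]
  refine Matrix.det_conj_of_mul_eq_one ?_ ?_
  · rw [← Matrix.map_mul, h1]; simp
  · rw [← Matrix.map_mul, h2]; simp

theorem Sim.quad {A : Matrix ι ι ℂ} {X : Matrix κ κ ℂ} (h : Sim A X) (q : Quad X) : Quad A := by
  obtain ⟨S, S', h1, h2, h3⟩ := h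
  obtain ⟨β, γ, hq⟩ := q
  refine ⟨β, γ, ?_⟩
  rw [Sim.sub h1 h3, Sim.sub h1 h3]
  calc _ = S * ((X - β • (1 : Matrix κ κ ℂ)) * (S' * S) * (X - γ • (1 : Matrix κ κ ℂ))) * S' := by
        simp only [Matrix.mul_assoc]
    _ = 0 := by rw [h2, Matrix.mul_one, hq]; simp

theorem Sim.scal {A : Matrix ι ι ℂ} {X : Matrix κ κ ℂ} (h : Sim A X) (q : Scal X) : Scal A := by
  obtain ⟨S, S', h1, h2, h3⟩ := h
  obtain ⟨β, hq⟩ := q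
  exact ⟨β, by rw [h3, hq]; simp [h1]⟩

theorem Scal.quad {A : Matrix ι ι ℂ} (h : Scal A) : Quad A := by
  obtain ⟨β, h⟩ := h
  exact ⟨β, β, by rw [h]; simp⟩

theorem gm_add_rank (A : Matrix ι ι ℂ) (μ : ℂ) :
    gm A μ + (A - μ • (1 : Matrix ι ι ℂ)).rank = Fintype.card ι := by
  have := LinearMap.finrank_range_add_finrank_ker (A - μ • (1 : Matrix ι ι ℂ)).mulVecLin
  rw [Module.finrank_fintype_fun_eq_card] at this
  rw [gm, Matrix.rank]; omega

theorem gm_le_card (A : Matrix ι ι ℂ) (μ : ℂ) : gm A μ ≤ Fintype.card ι := by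
  have := gm_add_rank A μ; omega

theorem gm_pos_iff (A : Matrix ι ι ℂ) (μ : ℂ) : 0 < gm A μ ↔ ∃ v, v ≠ 0 ∧ A *ᵥ v = μ • v := by
  have hm : ∀ v, v ∈ LinearMap.ker (A - μ • (1 : Matrix ι ι ℂ)).mulVecLin ↔ A *ᵥ v = μ • v := by
    intro v
    rw [LinearMap.mem_ker, Matrix.mulVecLin_apply, Matrix.sub_mulVec, Matrix.smul_mulVec, Matrix.one_mulVec, sub_eq_zero]
  unfold gm
  rw [Nat.pos_iff_ne_zero, Ne, Submodule.finrank_eq_zero, Submodule.eq_bot_iff]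
  push Not
  constructor
  · rintro ⟨v, h1, h2⟩; exact ⟨v, h2, (hm v).1 h1⟩
  · rintro ⟨v, h1, h2⟩; exact ⟨v, (hm v).2 h2, h1⟩

theorem det_sub_eq_zero_iff (A : Matrix ι ι ℂ) (μ : ℂ) :
    (A - μ • (1 : Matrix ι ι ℂ)).det = 0 ↔ 0 < gm A μ := by
  rw [← Matrix.exists_mulVec_eq_zero_iff, gm_pos_iff]
  refine exists_congr fun v => and_congr_right fun _ => ?_
  rw [Matrix.sub_mulVec, Matrix.smul_mulVec, Matrix.one_mulVec, sub_eq_zero]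

theorem charpoly_eval_iff (A : Matrix ι ι ℂ) (μ : ℂ) : A.charpoly.eval μ = 0 ↔ 0 < gm A μ := by
  rw [← det_sub_eq_zero_iff, Matrix.eval_charpoly, Matrix.scalar_apply, ← Matrix.smul_one_eq_diagonal,
    ← neg_sub, Matrix.det_neg]
  simp

theorem quad_sum {A : Matrix ι ι ℂ} {β γ : ℂ}
    (h : (A - β • (1 : Matrix ι ι ℂ)) * (A - γ • (1 : Matrix ι ι ℂ)) = 0) :
    Fintype.card ι ≤ gm A β + gm A γ := by
  have h1 : LinearMap.range (A - γ • (1 : Matrix ι ι ℂ)).mulVecLin ≤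
      LinearMap.ker (A - β • (1 : Matrix ι ι ℂ)).mulVecLin := by
    rw [LinearMap.range_le_ker_iff, ← Matrix.mulVecLin_mul, h]; simp
  have h2 := Submodule.finrank_mono h1
  have h3 := gm_add_rank A γ
  rw [Matrix.rank] at h3
  unfold gm at *
  omega

theorem mem_ker_sub (A : Matrix ι ι ℂ) (μ : ℂ) (v : ι → ℂ) :
    v ∈ LinearMap.ker (A - μ • (1 : Matrix ι ι ℂ)).mulVecLin ↔ A *ᵥ v = μ • v := by
  rw [LinearMap.mem_ker, Matrix.mulVecLin_apply, Matrix.sub_mulVec, Matrix.smul_mulVec, Matrix.one_mulVec, sub_eq_zero]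

theorem quad_of_sum {A : Matrix ι ι ℂ} {β γ : ℂ} (hne : β ≠ γ) (h : Fintype.card ι ≤ gm A β + gm A γ) :
    (A - β • (1 : Matrix ι ι ℂ)) * (A - γ • (1 : Matrix ι ι ℂ)) = 0 := by
  have hd : LinearMap.ker (A - β • (1 : Matrix ι ι ℂ)).mulVecLin ⊓
      LinearMap.ker (A - γ • (1 : Matrix ι ι ℂ)).mulVecLin = ⊥ := by
    rw [Submodule.eq_bot_iff]
    rintro v ⟨h1, h2⟩
    rw [SetLike.mem_coe, mem_ker_sub] at h1 h2
    rw [h1, ← sub_eq_zero, ← sub_smul, smul_eq_zero, sub_eq_zero] at h2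
    exact h2.resolve_left hne
  have hs := Submodule.finrank_sup_add_finrank_inf_eq (LinearMap.ker (A - β • (1 : Matrix ι ι ℂ)).mulVecLin)
      (LinearMap.ker (A - γ • (1 : Matrix ι ι ℂ)).mulVecLin)
  rw [hd, finrank_bot, add_zero] at hs
  have ht : LinearMap.ker (A - β • (1 : Matrix ι ι ℂ)).mulVecLin ⊔
      LinearMap.ker (A - γ • (1 : Matrix ι ι ℂ)).mulVecLin = ⊤ := by
    apply Submodule.eq_top_of_finrank_eq
    refine le_antisymm (Submodule.finrank_le _) ?_
    rw [Module.finrank_fintype_fun_eq_card, hs]; exact h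
  have hc : (A - β • (1 : Matrix ι ι ℂ)) * (A - γ • (1 : Matrix ι ι ℂ)) =
      (A - γ • (1 : Matrix ι ι ℂ)) * (A - β • (1 : Matrix ι ι ℂ)) := by
    simp only [Matrix.mul_sub, Matrix.sub_mul, Matrix.smul_mul, Matrix.mul_smul, Matrix.one_mul, Matrix.mul_one, smul_sub, smul_smul, mul_comm γ β]; abel
  apply Matrix.ext_of_mulVec_single
  intro i
  have hi : (Pi.single i 1 : ι → ℂ) ∈ LinearMap.ker (A - β • (1 : Matrix ι ι ℂ)).mulVecLin ⊔
      LinearMap.ker (A - γ • (1 : Matrix ι ι ℂ)).mulVecLin := by rw [ht]; trivial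
  obtain ⟨a, ha, b, hb, hab⟩ := Submodule.mem_sup.1 hi
  rw [LinearMap.mem_ker, Matrix.mulVecLin_apply] at ha hb
  rw [← hab, Matrix.mulVec_add]
  nth_rw 1 [hc]
  rw [← Matrix.mulVec_mulVec, ha, ← Matrix.mulVec_mulVec, hb]
  simp

theorem quad_of_gm {A : Matrix ι ι ℂ} {μ : ℂ} (h : Fintype.card ι ≤ gm A μ + 1) : Quad A := by
  have hr : (A - μ • (1 : Matrix ι ι ℂ)).rank ≤ 1 := by have := gm_add_rank A μ; omega
  rw [Matrix.rank, finrank_le_one_iff] at hr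
  obtain ⟨⟨w, hw⟩, hw2⟩ := hr
  obtain ⟨a, ha⟩ := hw2 ⟨(A - μ • (1 : Matrix ι ι ℂ)) *ᵥ w, ⟨w, rfl⟩⟩
  have ha' : a • w = (A - μ • (1 : Matrix ι ι ℂ)) *ᵥ w := congrArg Subtype.val ha
  refine ⟨μ + a, μ, ?_⟩
  apply Matrix.ext_of_mulVec_single
  intro i
  obtain ⟨b, hb⟩ := hw2 ⟨(A - μ • (1 : Matrix ι ι ℂ)) *ᵥ (Pi.single i 1), ⟨_, rfl⟩⟩
  have hb' : b • w = (A - μ • (1 : Matrix ι ι ℂ)) *ᵥ (Pi.single i 1) := congrArg Subtype.val hb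
  rw [← Matrix.mulVec_mulVec, ← hb', add_smul, ← sub_sub, Matrix.sub_mulVec, Matrix.mulVec_smul, ← ha',
    Matrix.smul_mulVec, Matrix.one_mulVec, smul_comm, sub_self, Matrix.zero_mulVec]

theorem scal_of_gm {A : Matrix ι ι ℂ} {μ : ℂ} (h : Fintype.card ι ≤ gm A μ) : A = μ • (1 : Matrix ι ι ℂ) := by
  have hr : (A - μ • (1 : Matrix ι ι ℂ)).rank = 0 := by have := gm_add_rank A μ; omega
  rw [Matrix.rank, Submodule.finrank_eq_zero, LinearMap.range_eq_bot] at hr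
  rw [← sub_eq_zero]
  apply Matrix.ext_of_mulVec_single
  intro i
  have := LinearMap.congr_fun hr (Pi.single i 1)
  rw [Matrix.zero_mulVec]; exact this

theorem gm_scal (μ ν : ℂ) : gm (μ • (1 : Matrix ι ι ℂ)) ν = if μ = ν then Fintype.card ι else 0 := by
  split_ifs with h
  · subst h
    have := gm_add_rank (μ • (1 : Matrix ι ι ℂ)) μ
    rw [sub_self, Matrix.rank_zero] at this; exact this
  · by_contra h0
    obtain ⟨v, hv, hv2⟩ := (gm_pos_iff _ _).1 (Nat.pos_of_ne_zero h0)
    rw [Matrix.smul_mulVec, Matrix.one_mulVec, ← sub_eq_zero, ← sub_smul, smul_eq_zero, sub_eq_zero] at hv2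
    exact hv2.elim h hv

theorem exists_gm_pos [Nonempty ι] (A : Matrix ι ι ℂ) : ∃ μ, 0 < gm A μ := by
  obtain ⟨μ, h⟩ := IsAlgClosed.exists_root A.charpoly (by
    rw [Matrix.charpoly_degree_eq_dim]; exact_mod_cast Fintype.card_ne_zero)
  exact ⟨μ, (charpoly_eval_iff A μ).1 h⟩

theorem isUnit_iff_gm (A : Matrix ι ι ℂ) : IsUnit A ↔ gm A 0 = 0 := by
  have := det_sub_eq_zero_iff A 0
  rw [zero_smul, sub_zero] at this
  rw [Matrix.isUnit_iff_isUnit_det, isUnit_iff_ne_zero, Ne, this]; omega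

theorem Sim.isUnit {A : Matrix ι ι ℂ} {X : Matrix κ κ ℂ} (h : Sim A X) (hX : IsUnit X) : IsUnit A := by
  rw [isUnit_iff_gm] at *; rw [h.gm_eq, hX]

end basics

theorem sameClass_iff {n : ℕ} (A B : Matrix (Fin n) (Fin n) ℂ) : SameClass A B ↔ Sim A B := by
  constructor
  · rintro ⟨S, hS, h⟩
    rw [Matrix.isUnit_iff_isUnit_det] at hS
    exact ⟨S, S⁻¹, Matrix.mul_nonsing_inv _ hS, Matrix.nonsing_inv_mul _ hS, h⟩
  · rintro ⟨S, S', h1, h2, h3⟩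
    have : S⁻¹ = S' := Matrix.inv_eq_right_inv h1
    exact ⟨S, ⟨⟨S, S', h1, h2⟩, rfl⟩, by rw [this]; exact h3⟩

section m3
variable {ι : Type} [Fintype ι] [DecidableEq ι]

abbrev I3 (ι : Type) := Unit ⊕ (ι ⊕ Unit)

def M3 (a : ℂ) (b : ι → ℂ) (c : ℂ) (d : ι → ℂ) (E : Matrix ι ι ℂ) (f : ι → ℂ) (g : ℂ) (h : ι → ℂ) (i : ℂ) :
    Matrix (I3 ι) (I3 ι) ℂ :=
  fromBlocks (of fun _ _ => a) (of fun _ j => Sum.elim b (fun _ => c) j)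
    (of fun i _ => Sum.elim d (fun _ => g) i)
    (fromBlocks E (of fun i _ => f i) (of fun _ j => h j) (of fun _ _ => i))

theorem M3_eta (X : Matrix (I3 ι) (I3 ι) ℂ) : X = M3 (X (.inl ()) (.inl ())) (fun j => X (.inl ()) (.inr (.inl j)))
    (X (.inl ()) (.inr (.inr ()))) (fun i => X (.inr (.inl i)) (.inl ())) (fun i j => X (.inr (.inl i)) (.inr (.inl j)))
    (fun i => X (.inr (.inl i)) (.inr (.inr ()))) (X (.inr (.inr ())) (.inl ()))
    (fun j => X (.inr (.inr ())) (.inr (.inl j))) (X (.inr (.inr ())) (.inr (.inr ()))) := by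
  ext i j
  rcases i with _ | i | _ <;> rcases j with _ | j | _ <;> rfl

theorem M3_inj {a b c d E f g h i a' b' c' d' E' f' g' h' i'}
    (H : M3 (ι := ι) a b c d E f g h i = M3 a' b' c' d' E' f' g' h' i') :
    a = a' ∧ b = b' ∧ c = c' ∧ d = d' ∧ E = E' ∧ f = f' ∧ g = g' ∧ h = h' ∧ i = i' := by
  refine ⟨congrFun (congrFun H (.inl ())) (.inl ()), funext fun j => congrFun (congrFun H (.inl ())) (.inr (.inl j)),
    congrFun (congrFun H (.inl ())) (.inr (.inr ())), funext fun i => congrFun (congrFun H (.inr (.inl i))) (.inl ()),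
    funext fun i => funext fun j => congrFun (congrFun H (.inr (.inl i))) (.inr (.inl j)),
    funext fun i => congrFun (congrFun H (.inr (.inl i))) (.inr (.inr ())), congrFun (congrFun H (.inr (.inr ()))) (.inl ()),
    funext fun j => congrFun (congrFun H (.inr (.inr ()))) (.inr (.inl j)), congrFun (congrFun H (.inr (.inr ()))) (.inr (.inr ()))⟩

theorem M3_mul (a : ℂ) (b : ι → ℂ) (c : ℂ) (d : ι → ℂ) (E : Matrix ι ι ℂ) (f : ι → ℂ) (g : ℂ) (h : ι → ℂ) (i : ℂ)
    (a' : ℂ) (b' : ι → ℂ) (c' : ℂ) (d' : ι → ℂ) (E' : Matrix ι ι ℂ) (f' : ι → ℂ) (g' : ℂ) (h' : ι → ℂ) (i' : ℂ) :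
    M3 a b c d E f g h i * M3 a' b' c' d' E' f' g' h' i' =
    M3 (a * a' + b ⬝ᵥ d' + c * g') (a • b' + b ᵥ* E' + c • h') (a * c' + b ⬝ᵥ f' + c * i')
      (a' • d + E *ᵥ d' + g' • f) (vecMulVec d b' + E * E' + vecMulVec f h') (c' • d + E *ᵥ f' + i' • f)
      (g * a' + h ⬝ᵥ d' + i * g') (g • b' + h ᵥ* E' + i • h') (g * c' + h ⬝ᵥ f' + i * i') := by
  ext k l
  rcases k with _ | k | _ <;> rcases l with _ | l | _ <;>
    simp [M3, Matrix.mul_apply, dotProduct, vecMul, mulVec, vecMulVec, Fintype.sum_sum_type] <;> ring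

theorem M3_one : (1 : Matrix (I3 ι) (I3 ι) ℂ) = M3 1 0 0 0 1 0 0 0 1 := by
  ext k l
  rcases k with _ | k | _ <;> rcases l with _ | l | _ <;> simp [M3, Matrix.one_apply]

theorem M3_smul (z a : ℂ) (b : ι → ℂ) (c : ℂ) (d : ι → ℂ) (E : Matrix ι ι ℂ) (f : ι → ℂ) (g : ℂ) (h : ι → ℂ) (i : ℂ) :
    z • M3 a b c d E f g h i = M3 (z * a) (z • b) (z * c) (z • d) (z • E) (z • f) (z * g) (z • h) (z * i) := by
  ext k l
  rcases k with _ | k | _ <;> rcases l with _ | l | _ <;> simp [M3]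

theorem charpoly_unit (a : ℂ) : (of fun (_ _ : Unit) => a).charpoly = X - C a := by
  simp [Matrix.charpoly]

theorem M3_upper_charpoly (a : ℂ) (b : ι → ℂ) (c : ℂ) (E : Matrix ι ι ℂ) (f : ι → ℂ) (i : ℂ) :
    (M3 a b c 0 E f 0 0 i).charpoly = (X - C a) * (E.charpoly * (X - C i)) := by
  have : M3 a b c 0 E f 0 0 i = fromBlocks (of fun _ _ => a) (of fun _ j => Sum.elim b (fun _ => c) j) 0
    (fromBlocks E (of fun i _ => f i) 0 (of fun _ _ => i)) := by
    ext k l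
    rcases k with _ | k | _ <;> rcases l with _ | l | _ <;> simp [M3]
  rw [this, Matrix.charpoly_fromBlocks_zero₂₁, Matrix.charpoly_fromBlocks_zero₂₁, charpoly_unit, charpoly_unit]

theorem M3_upper_det (a : ℂ) (b : ι → ℂ) (c : ℂ) (E : Matrix ι ι ℂ) (f : ι → ℂ) (i : ℂ) :
    (M3 a b c 0 E f 0 0 i).det = a * (E.det * i) := by
  have : M3 a b c 0 E f 0 0 i = fromBlocks (of fun _ _ => a) (of fun _ j => Sum.elim b (fun _ => c) j) 0
    (fromBlocks E (of fun i _ => f i) 0 (of fun _ _ => i)) := by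
    ext k l
    rcases k with _ | k | _ <;> rcases l with _ | l | _ <;> simp [M3]
  rw [this, Matrix.det_fromBlocks_zero₂₁, Matrix.det_fromBlocks_zero₂₁]; simp

end m3

theorem layer_core {m : ℕ} (A : Matrix (Fin (m+2)) (Fin (m+2)) ℂ) (x y : Fin (m+2) → ℂ)
    (φ : (Fin (m+2) → ℂ) →ₗ[ℂ] ℂ) (hxy : A *ᵥ y = x) (hx : φ x = 0) (hy : φ y ≠ 0) (hc : φ (A *ᵥ x) ≠ 0)
    (e : Fin m → (Fin (m+2) → ℂ)) (he : LinearIndependent ℂ e) (he1 : ∀ i, φ (e i) = 0)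
    (he2 : ∀ i, φ (A *ᵥ e i) = 0) :
    ∃ (P : ℂ) (p p' : Fin m → ℂ) (A' : Matrix (Fin m) (Fin m) ℂ), Sim A (M3 P p 1 p' A' 0 (φ (A *ᵥ x) / φ y) 0 0) ∧
      (∀ j, A *ᵥ e j = p j • x + ∑ i, A' i j • e i) ∧
      A *ᵥ x = P • x + ∑ i, p' i • e i + (φ (A *ᵥ x) / φ y) • y := by
  have hli : LinearIndependent ℂ (Sum.elim (fun _ : Unit => x) (Sum.elim e (fun _ : Unit => y))) := by
    rw [Fintype.linearIndependent_iff]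
    intro g hg
    simp only [Fintype.sum_sum_type, Sum.elim_inl, Sum.elim_inr, Finset.univ_unique, Finset.sum_singleton] at hg
    have h1 := congrArg φ hg
    simp only [map_add, map_smul, map_sum, he1, hx, smul_zero, Finset.sum_const_zero, zero_add, map_zero,
      smul_eq_mul, mul_zero, zero_add, Finset.sum_const_zero, mul_eq_zero, hy, or_false] at h1
    have h2 := congrArg (fun v => φ (A.mulVecLin v)) hg
    simp only [map_add, map_smul, map_sum, Matrix.mulVecLin_apply, he2, hxy, hx, smul_zero, Finset.sum_const_zero, add_zero, map_zero,
      smul_eq_mul, mul_zero, add_zero, Finset.sum_const_zero, mul_eq_zero, hc, or_false] at h2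
    rw [h1, h2] at hg
    simp only [zero_smul, zero_add, add_zero] at hg
    have h3 := Fintype.linearIndependent_iff.1 he _ hg
    rintro (⟨⟩ | i | ⟨⟩)
    · exact h2
    · exact h3 i
    · exact h1
  let b := basisOfLinearIndependentOfCardEqFinrank hli (by simp; omega)
  have hb : ∀ k, b k = Sum.elim (fun _ : Unit => x) (Sum.elim e (fun _ : Unit => y)) k := by
    intro k; simp [b]
  have hbx : b (.inl ()) = x := hb _
  have hbe : ∀ i, b (.inr (.inl i)) = e i := fun i => hb _
  have hby : b (.inr (.inr ())) = y := hb _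
  let X := LinearMap.toMatrix b b A.mulVecLin
  have hX : ∀ k l, X k l = b.repr (A *ᵥ (b l)) k := by
    intro k l; simp [X, LinearMap.toMatrix_apply]
  have hcol : ∀ l, A *ᵥ (b l) = X (.inl ()) l • x + (∑ i, X (.inr (.inl i)) l • e i) + X (.inr (.inr ())) l • y := by
    intro l
    rw [← b.sum_repr (A *ᵥ (b l))]
    simp only [Fintype.sum_sum_type, Finset.univ_unique, Finset.sum_singleton, ← hX]
    simp only [← hbx, ← hby, ← hbe, ← add_assoc]
  have hrow : ∀ l, X (.inr (.inr ())) l = φ (A *ᵥ b l) / φ y := by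
    intro l
    rw [eq_div_iff hy]
    conv_rhs => rw [hcol l]
    simp [map_add, map_smul, map_sum, hx, he1]
  have hlast : ∀ k, X k (.inr (.inr ())) = if k = .inl () then 1 else 0 := by
    intro k
    rw [hX, hby, hxy, ← hbx, Module.Basis.repr_self, Finsupp.single_apply]
    simp only [eq_comm]
  have hXM : X = M3 (X (.inl ()) (.inl ())) (fun j => X (.inl ()) (.inr (.inl j))) 1
      (fun i => X (.inr (.inl i)) (.inl ())) (fun i j => X (.inr (.inl i)) (.inr (.inl j))) 0
      (φ (A *ᵥ x) / φ y) 0 0 := by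
    conv_lhs => rw [M3_eta X]
    congr 1
    · rw [hlast]; simp
    · ext i; rw [hlast]; simp
    · rw [hrow, hbx]
    · ext i; rw [hrow, hbe, he2]; simp
    · rw [hlast]; simp
  refine ⟨X (.inl ()) (.inl ()), fun j => X (.inl ()) (.inr (.inl j)), fun i => X (.inr (.inl i)) (.inl ()),
    fun i j => X (.inr (.inl i)) (.inr (.inl j)), ?_, ?_, ?_⟩
  · rw [← hXM]
    refine ⟨(Pi.basisFun ℂ (Fin (m+2))).toMatrix b, b.toMatrix (Pi.basisFun ℂ (Fin (m+2))), ?_, ?_, ?_⟩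
    · exact Module.Basis.toMatrix_mul_toMatrix_flip _ _
    · exact Module.Basis.toMatrix_mul_toMatrix_flip _ _
    · rw [basis_toMatrix_mul_linearMap_toMatrix_mul_basis_toMatrix]
      rw [LinearMap.toMatrix_eq_toMatrix']
      exact (LinearMap.toMatrix'_toLin' A).symm
  · intro j
    have := hcol (.inr (.inl j))
    rw [hbe, hrow, hbe, he2, zero_div, zero_smul, add_zero] at this
    exact this
  · have := hcol (.inl ())
    rw [hrow, hbx] at this
    exact this

theorem M3_unit {m : ℕ} {P : ℂ} {p p' : Fin m → ℂ} {A' : Matrix (Fin m) (Fin m) ℂ} {c : ℂ}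
    (h : IsUnit (M3 P p 1 p' A' 0 c 0 0)) : IsUnit A' := by
  have hR : M3 (ι := Fin m) 0 0 1 0 1 0 1 0 0 * M3 0 0 1 0 1 0 1 0 0 = 1 := by
    rw [M3_mul, M3_one]; simp
  have hRu : IsUnit (M3 (ι := Fin m) 0 0 1 0 1 0 1 0 0) := ⟨⟨_, _, hR, hR⟩, rfl⟩
  have h2 := h.mul hRu
  have e : M3 P p 1 p' A' 0 c 0 0 * M3 0 0 1 0 1 0 1 0 0 = M3 1 p P 0 A' p' 0 0 c := by
    rw [M3_mul]; simp
  rw [e, Matrix.isUnit_iff_isUnit_det] at h2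
  rw [Matrix.isUnit_iff_isUnit_det, isUnit_iff_ne_zero]
  have h3 := h2.ne_zero
  rw [M3_upper_det] at h3
  intro h4
  apply h3; rw [h4]; ring

theorem layer_core2 {m : ℕ} (A : Matrix (Fin (m+2)) (Fin (m+2)) ℂ) (hA : IsUnit A) (x y : Fin (m+2) → ℂ)
    (φ : (Fin (m+2) → ℂ) →ₗ[ℂ] ℂ) (hxy : A *ᵥ y = x) (hx : φ x = 0) (hy : φ y ≠ 0) (hc : φ (A *ᵥ x) ≠ 0)
    (hyr : ∀ μ, 0 < gm A μ → ∀ v, A *ᵥ v - μ • v ≠ y)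
    (hφ : ∀ μ, 2 ≤ gm A μ → ∃ v, A *ᵥ v = μ • v ∧ φ v ≠ 0) :
    ∃ (P : ℂ) (p p' : Fin m → ℂ) (A' : Matrix (Fin m) (Fin m) ℂ), Sim A (M3 P p 1 p' A' 0 (φ (A *ᵥ x) / φ y) 0 0) ∧ IsUnit A' ∧
      (∀ μ, gm A' μ ≤ 1 ∨ gm A' μ + 1 ≤ gm A μ) ∧
      (p' = 0 → A *ᵥ x = P • x + (φ (A *ᵥ x) / φ y) • y) := by
  let E := LinearMap.ker (φ.prod (φ ∘ₗ A.mulVecLin))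
  have hE : m ≤ Module.finrank ℂ E := by
    have h1 := LinearMap.finrank_range_add_finrank_ker (φ.prod (φ ∘ₗ A.mulVecLin))
    have h2 := Submodule.finrank_le (LinearMap.range (φ.prod (φ ∘ₗ A.mulVecLin)))
    simp only [Module.finrank_prod, Module.finrank_self, Module.finrank_fintype_fun_eq_card, Fintype.card_fin] at h1 h2
    change m ≤ Module.finrank ℂ (LinearMap.ker (φ.prod (φ ∘ₗ A.mulVecLin)))
    omega
  have hmem : ∀ v, v ∈ E ↔ φ v = 0 ∧ φ (A *ᵥ v) = 0 := by
    intro v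
    simp [E, LinearMap.mem_ker, Prod.ext_iff]
  let bE := Module.finBasis ℂ E
  let e : Fin m → (Fin (m+2) → ℂ) := fun i => (bE (Fin.castLE hE i) : Fin (m+2) → ℂ)
  have he : LinearIndependent ℂ e := by
    have := bE.linearIndependent.comp _ (Fin.castLE_injective hE)
    exact this.map' E.subtype (by simp)
  have he0 : ∀ i, φ (e i) = 0 ∧ φ (A *ᵥ e i) = 0 := fun i => (hmem _).1 (bE (Fin.castLE hE i)).2
  obtain ⟨P, p, p', A', hS, hAe, hAx⟩ := layer_core A x y φ hxy hx hy hc e he (fun i => (he0 i).1) (fun i => (he0 i).2)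
  refine ⟨P, p, p', A', hS, M3_unit (hS.symm.isUnit hA), ?_, ?_⟩
  swap
  · rintro rfl
    simpa using hAx
  intro μ
  -- the map u ↦ e(u)
  let J : (Fin m → ℂ) →ₗ[ℂ] (Fin (m+2) → ℂ) := Fintype.linearCombination ℂ e
  have hJ : ∀ u, J u = ∑ i, u i • e i := fun u => rfl
  have hJinj : Function.Injective J := by
    rw [injective_iff_map_eq_zero]
    intro u hu
    exact funext (Fintype.linearIndependent_iff.1 he u hu)
  have hJφ : ∀ u, φ (J u) = 0 := by
    intro u; rw [hJ]; simp [map_sum, (he0 _).1]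
  have hAJ : ∀ u, A *ᵥ (J u) = (p ⬝ᵥ u) • x + J (A' *ᵥ u) := by
    intro u
    rw [hJ, hJ, Matrix.mulVec_sum]
    simp only [Matrix.mulVec_smul, hAe, smul_add, Finset.sum_add_distrib, Finset.smul_sum]
    congr 1
    · rw [dotProduct, Finset.sum_smul]
      refine Finset.sum_congr rfl fun i _ => ?_
      rw [smul_smul, mul_comm]
    · rw [Finset.sum_comm]
      refine Finset.sum_congr rfl fun i _ => ?_
      rw [mulVec, dotProduct, Finset.sum_smul]
      refine Finset.sum_congr rfl fun j _ => ?_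
      rw [smul_smul, mul_comm]
  have hk : ∀ u, u ∈ LinearMap.ker (A' - μ • (1 : Matrix _ _ ℂ)).mulVecLin → A *ᵥ (J u) = (p ⬝ᵥ u) • x + μ • J u := by
    intro u hu
    rw [mem_ker_sub] at hu
    rw [hAJ, hu, map_smul]
  by_cases h0 : 0 < gm A μ
  · have hpu : ∀ u, u ∈ LinearMap.ker (A' - μ • (1 : Matrix _ _ ℂ)).mulVecLin → p ⬝ᵥ u = 0 := by
      intro u hu
      by_contra hpu
      have hμ : μ ≠ 0 := by
        rintro rfl
        rw [isUnit_iff_gm] at hA; omega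
      refine hyr μ h0 (μ⁻¹ • ((p ⬝ᵥ u)⁻¹ • J u - y)) ?_
      have := hk u hu
      rw [Matrix.mulVec_smul, Matrix.mulVec_sub, Matrix.mulVec_smul, this, hxy]
      ext i
      simp only [Pi.sub_apply, Pi.smul_apply, Pi.add_apply, smul_eq_mul]
      field_simp
      ring
    by_cases h1 : 2 ≤ gm A μ
    · right
      obtain ⟨v, hv, hφv⟩ := hφ μ h1
      have hlt : LinearMap.ker (A - μ • (1 : Matrix _ _ ℂ)).mulVecLin ⊓ LinearMap.ker φ <
          LinearMap.ker (A - μ • (1 : Matrix _ _ ℂ)).mulVecLin := by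
        refine lt_of_le_of_ne inf_le_left ?_
        intro h
        have hv' : v ∈ LinearMap.ker (A - μ • (1 : Matrix _ _ ℂ)).mulVecLin := (mem_ker_sub _ _ _).2 hv
        rw [← h] at hv'
        exact hφv hv'.2
      have h2 := Submodule.finrank_lt_finrank_of_lt hlt
      have h3 : gm A' μ ≤ Module.finrank ℂ ↥(LinearMap.ker (A - μ • (1 : Matrix _ _ ℂ)).mulVecLin ⊓ LinearMap.ker φ) := by
        rw [gm]
        rw [LinearEquiv.finrank_eq (Submodule.equivMapOfInjective J hJinj _)]
        apply Submodule.finrank_mono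
        rintro _ ⟨u, hu, rfl⟩
        refine ⟨?_, hJφ u⟩
        rw [SetLike.mem_coe, mem_ker_sub, hk u hu, hpu u hu, zero_smul, zero_add]
      rw [gm] at h3 ⊢
      rw [gm]; omega
    · left
      refine le_trans ?_ (show gm A μ ≤ 1 by omega)
      rw [gm]
      rw [LinearEquiv.finrank_eq (Submodule.equivMapOfInjective J hJinj _)]
      apply Submodule.finrank_mono
      rintro _ ⟨u, hu, rfl⟩
      rw [mem_ker_sub, hk u hu, hpu u hu, zero_smul, zero_add]
  · left
    have : ∀ u, u ∈ LinearMap.ker (A' - μ • (1 : Matrix _ _ ℂ)).mulVecLin → p ⬝ᵥ u = 0 → u = 0 := by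
      intro u hu h
      have h2 := hk u hu
      rw [h, zero_smul, zero_add] at h2
      by_contra hu0
      exact h0 ((gm_pos_iff _ _).2 ⟨J u, fun h => hu0 (hJinj (h.trans (map_zero J).symm)), h2⟩)
    let F : (LinearMap.ker (A' - μ • (1 : Matrix _ _ ℂ)).mulVecLin) →ₗ[ℂ] ℂ :=
      (dotProductBilin ℂ ℂ p) ∘ₗ Submodule.subtype _
    have hF : Function.Injective F := by
      rw [injective_iff_map_eq_zero]
      rintro ⟨u, hu⟩ h
      exact Subtype.ext (this u hu h)
    have := LinearMap.finrank_le_finrank_of_injective hF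
    rwa [Module.finrank_self] at this

theorem finite_gm {ι : Type} [Fintype ι] [DecidableEq ι] (A : Matrix ι ι ℂ) : {μ | 0 < gm A μ}.Finite := by
  refine Set.Finite.subset (A.charpoly.roots.toFinset.finite_toSet) ?_
  intro μ hμ
  have : A.charpoly.eval μ = 0 := (charpoly_eval_iff A μ).2 hμ
  simp [A.charpoly_monic.ne_zero, Polynomial.IsRoot, this]

theorem ker_eq_top {ι : Type} [Fintype ι] [DecidableEq ι] {M : Matrix ι ι ℂ}
    (h : LinearMap.ker M.mulVecLin = ⊤) : M = 0 := by
  rw [LinearMap.ker_eq_top] at h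
  apply Matrix.ext_of_mulVec_single
  intro i
  have := LinearMap.congr_fun h (Pi.single i 1)
  rw [Matrix.zero_mulVec]; exact this

theorem choose_y {m : ℕ} (A : Matrix (Fin (m+2)) (Fin (m+2)) ℂ) (hns : ¬ Scal A) :
    ∃ y : Fin (m+2) → ℂ, (∀ μ : ℂ, 0 < gm A μ → ∀ v, A *ᵥ v - μ • v ≠ y) ∧ (∀ μ : ℂ, A *ᵥ y ≠ μ • y) ∧
      (¬ Quad A → ∀ β γ : ℂ, ((A - β • (1 : Matrix _ _ ℂ)) * (A - γ • (1 : Matrix _ _ ℂ))) *ᵥ y ≠ 0) := by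
  classical
  have hf := finite_gm A
  let Λ := {μ // 0 < gm A μ}
  haveI : Finite Λ := hf
  let Ω : Λ ⊕ (Λ ⊕ Λ × Λ) → Submodule ℂ (Fin (m+2) → ℂ) := Sum.elim
    (fun μ => LinearMap.range (A - μ.1 • (1 : Matrix _ _ ℂ)).mulVecLin)
    (Sum.elim (fun μ => LinearMap.ker (A - μ.1 • (1 : Matrix _ _ ℂ)).mulVecLin)
      (fun μ => if Quad A then ⊥ else
        LinearMap.ker ((A - μ.1.1 • (1 : Matrix _ _ ℂ)) * (A - μ.2.1 • (1 : Matrix _ _ ℂ))).mulVecLin))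
  obtain ⟨y, hy⟩ := Submodule.exists_forall_notMem_of_forall_ne_top Ω (by
    rintro (μ | μ | μ) h
    · have h1 := gm_add_rank A μ.1
      change LinearMap.range (A - μ.1 • (1 : Matrix _ _ ℂ)).mulVecLin = ⊤ at h
      rw [Matrix.rank, h, finrank_top, Module.finrank_fintype_fun_eq_card] at h1
      have := μ.2
      omega
    · exact hns ⟨μ.1, sub_eq_zero.1 (ker_eq_top h)⟩
    · by_cases hq : Quad A
      · simp only [Ω, Sum.elim_inr, if_pos hq] at h
        exact bot_ne_top h
      · simp only [Ω, Sum.elim_inr, if_neg hq] at h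
        exact hq ⟨_, _, ker_eq_top h⟩)
  have h1 : ∀ μ, 0 < gm A μ → ∀ v, A *ᵥ v - μ • v ≠ y := by
    intro μ hμ v hv
    apply hy (.inl ⟨μ, hμ⟩)
    refine ⟨v, ?_⟩
    rw [Matrix.mulVecLin_apply, Matrix.sub_mulVec, Matrix.smul_mulVec, Matrix.one_mulVec, hv]
  have hy0 : y ≠ 0 := by
    rintro rfl
    obtain ⟨μ, hμ⟩ := exists_gm_pos A
    exact hy (.inl ⟨μ, hμ⟩) (Submodule.zero_mem _)
  have h2 : ∀ μ : ℂ, A *ᵥ y ≠ μ • y := by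
    intro μ h
    exact hy (.inr (.inl ⟨μ, (gm_pos_iff _ _).2 ⟨y, hy0, h⟩⟩)) ((mem_ker_sub _ _ _).2 h)
  refine ⟨y, h1, h2, ?_⟩
  intro hq β γ h
  have hc : ∀ β γ : ℂ, (A - β • (1 : Matrix _ _ ℂ)) * (A - γ • (1 : Matrix _ _ ℂ)) =
      (A - γ • (1 : Matrix _ _ ℂ)) * (A - β • (1 : Matrix _ _ ℂ)) := by
    intro β γ
    simp only [Matrix.mul_sub, Matrix.sub_mul, Matrix.smul_mul, Matrix.mul_smul, Matrix.one_mul, Matrix.mul_one, smul_sub, smul_smul, mul_comm γ β]; abel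
  have key : ∀ β γ : ℂ, ((A - β • (1 : Matrix _ _ ℂ)) * (A - γ • (1 : Matrix _ _ ℂ))) *ᵥ y = 0 → 0 < gm A β := by
    intro β γ h
    rw [← Matrix.mulVec_mulVec] at h
    refine (gm_pos_iff _ _).2 ⟨(A - γ • (1 : Matrix _ _ ℂ)) *ᵥ y, ?_, ?_⟩
    · intro h0
      exact h2 γ ((mem_ker_sub _ _ _).1 h0)
    · exact (mem_ker_sub _ _ _).1 h
  have hβ := key β γ h
  have hγ := key γ β (by rw [hc]; exact h)
  have := hy (.inr (.inr (⟨β, hβ⟩, ⟨γ, hγ⟩)))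
  simp only [Ω, Sum.elim_inr, if_neg hq] at this
  exact this h

theorem choose_phi {V ι : Type} [AddCommGroup V] [Module ℂ V] [Finite ι] (U : Submodule ℂ V) (v : ι → V)
    (hv : ∀ i, v i ∉ U) : ∃ φ : V →ₗ[ℂ] ℂ, (∀ u ∈ U, φ u = 0) ∧ ∀ i, φ (v i) ≠ 0 := by
  obtain ⟨f, hf⟩ := Module.exists_dual_forall_apply_ne_zero (K := ℂ) (fun i => U.mkQ (v i)) (by
    intro i h
    exact hv i ((Submodule.Quotient.mk_eq_zero U).1 h))
  refine ⟨f ∘ₗ U.mkQ, ?_, hf⟩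
  intro u hu
  rw [LinearMap.comp_apply, Submodule.mkQ_apply, (Submodule.Quotient.mk_eq_zero U).2 hu, map_zero]

theorem unit_inj {ι : Type} [Fintype ι] [DecidableEq ι] {A : Matrix ι ι ℂ} (hA : IsUnit A) {v w : ι → ℂ}
    (h : A *ᵥ v = A *ᵥ w) : v = w := Matrix.mulVec_injective_of_isUnit hA h

theorem layer_sel {m : ℕ} (A : Matrix (Fin (m+2)) (Fin (m+2)) ℂ) (hA : IsUnit A) (y w : Fin (m+2) → ℂ)
    (h2 : ∀ μ : ℂ, A *ᵥ y ≠ μ • y) (hy : y ∉ Submodule.span ℂ {A *ᵥ y, w})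
    (hx : A *ᵥ (A *ᵥ y) ∉ Submodule.span ℂ {A *ᵥ y, w}) :
    ∃ φ : (Fin (m+2) → ℂ) →ₗ[ℂ] ℂ, φ (A *ᵥ y) = 0 ∧ φ w = 0 ∧ φ y ≠ 0 ∧ φ (A *ᵥ (A *ᵥ y)) ≠ 0 ∧
      ∀ μ, 2 ≤ gm A μ → ∃ v, A *ᵥ v = μ • v ∧ φ v ≠ 0 := by
  classical
  let Λ := {μ // 2 ≤ gm A μ}
  haveI : Finite Λ := (finite_gm A).subset (fun μ (h : 2 ≤ gm A μ) => (by simp; omega))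
  have hex : ∀ μ : Λ, ∃ v, A *ᵥ v = μ.1 • v ∧ v ∉ Submodule.span ℂ {A *ᵥ y, w} := by
    intro μ
    by_contra! hcon
    have hle : LinearMap.ker (A - μ.1 • (1 : Matrix _ _ ℂ)).mulVecLin ≤ Submodule.span ℂ {A *ᵥ y, w} := by
      intro v hv
      exact hcon v ((mem_ker_sub _ _ _).1 hv)
    have hfr : Module.finrank ℂ (Submodule.span ℂ {A *ᵥ y, w}) ≤ 2 := by
      have := finrank_span_finset_le_card (R := ℂ) ({A *ᵥ y, w} : Finset (Fin (m+2) → ℂ))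
      rw [Finset.coe_pair] at this
      exact this.trans Finset.card_le_two
    have heq := Submodule.eq_of_le_of_finrank_le hle (hfr.trans μ.2)
    have hxm : A *ᵥ y ∈ LinearMap.ker (A - μ.1 • (1 : Matrix _ _ ℂ)).mulVecLin := by
      rw [heq]; exact Submodule.subset_span (by simp)
    rw [mem_ker_sub, ← Matrix.mulVec_smul] at hxm
    exact h2 _ (unit_inj hA hxm)
  choose v hv1 hv2 using hex
  obtain ⟨φ, h3, h4⟩ := choose_phi (Submodule.span ℂ {A *ᵥ y, w}) (Sum.elim v (fun b : Bool => if b then y else A *ᵥ (A *ᵥ y)))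
    (by rintro (μ | (_ | _)) <;> simp_all)
  refine ⟨φ, h3 _ (Submodule.subset_span (by simp)), h3 _ (Submodule.subset_span (by simp)), ?_, ?_, ?_⟩
  · simpa using h4 (.inr true)
  · simpa using h4 (.inr false)
  · intro μ hμ
    exact ⟨v ⟨μ, hμ⟩, hv1 _, by simpa using h4 (.inl ⟨μ, hμ⟩)⟩

theorem layer_gen {m : ℕ} (A : Matrix (Fin (m+2)) (Fin (m+2)) ℂ) (hA : IsUnit A) (hns : ¬ Scal A) :
    ∃ (c P : ℂ) (p p' : Fin m → ℂ) (A' : Matrix (Fin m) (Fin m) ℂ), c ≠ 0 ∧ Sim A (M3 P p 1 p' A' 0 c 0 0) ∧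
      IsUnit A' ∧ (∀ μ, gm A' μ ≤ 1 ∨ gm A' μ + 1 ≤ gm A μ) := by
  obtain ⟨y, h1, h2, -⟩ := choose_y A hns
  have hy0 : y ≠ 0 := by
    rintro rfl
    exact h2 0 (by simp)
  have hU : ∀ z, z ∈ Submodule.span ℂ {A *ᵥ y, (0 : Fin (m+2) → ℂ)} → ∃ a : ℂ, a • (A *ᵥ y) = z := by
    intro z hz
    rw [Submodule.mem_span_pair] at hz
    obtain ⟨a, b, h⟩ := hz
    exact ⟨a, by simpa using h⟩
  obtain ⟨φ, g1, -, g3, g4, g5⟩ := layer_sel A hA y 0 h2 (by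
      intro h
      obtain ⟨a, ha⟩ := hU _ h
      have ha0 : a ≠ 0 := by rintro rfl; exact hy0 (by simpa using ha.symm)
      apply h2 a⁻¹
      conv_rhs => rw [← ha]
      rw [smul_smul, inv_mul_cancel₀ ha0, one_smul]) (by
      intro h
      obtain ⟨a, ha⟩ := hU _ h
      rw [← Matrix.mulVec_smul] at ha
      exact h2 a (unit_inj hA ha).symm)
  obtain ⟨P, p, p', A', k1, k2, k3, -⟩ := layer_core2 A hA _ y φ rfl g1 g3 g4 h1 g5
  exact ⟨_, P, p, p', A', div_ne_zero g4 g3, k1, k2, k3⟩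

theorem quad_factor (a b : ℂ) : ∃ β γ : ℂ, β + γ = -a ∧ β * γ = b := by
  obtain ⟨s, hs⟩ := IsAlgClosed.exists_eq_mul_self (a ^ 2 - 4 * b)
  refine ⟨(-a + s) / 2, (-a - s) / 2, by ring, ?_⟩
  have : (-a + s) / 2 * ((-a - s) / 2) = (a ^ 2 - s * s) / 4 := by ring
  rw [this, ← hs]; ring

theorem layer_pre {m : ℕ} (A : Matrix (Fin (m+2)) (Fin (m+2)) ℂ) (hA : IsUnit A) (hq : ¬ Quad A) (c : ℂ) (hc : c ≠ 0) :
    ∃ (P : ℂ) (p p' : Fin m → ℂ) (A' : Matrix (Fin m) (Fin m) ℂ), Sim A (M3 P p 1 p' A' 0 c 0 0) ∧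
      IsUnit A' ∧ (∀ μ, gm A' μ ≤ 1 ∨ gm A' μ + 1 ≤ gm A μ) ∧ p' ≠ 0 := by
  obtain ⟨y, h1, h2, h3⟩ := choose_y A (fun h => hq h.quad)
  replace h3 := h3 hq
  have h4 : ∀ a b : ℂ, A *ᵥ (A *ᵥ y) + a • (A *ᵥ y) + b • y ≠ 0 := by
    intro a b h
    obtain ⟨β, γ, e1, e2⟩ := quad_factor a b
    apply h3 β γ
    rw [← Matrix.mulVec_mulVec, Matrix.sub_mulVec, Matrix.sub_mulVec, Matrix.smul_mulVec, Matrix.one_mulVec,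
      Matrix.smul_mulVec, Matrix.one_mulVec, Matrix.mulVec_sub, Matrix.mulVec_smul, ← h]
    have e3 : a = -(β + γ) := by rw [e1]; ring
    rw [e3, ← e2]
    ext i
    simp only [Pi.sub_apply, Pi.smul_apply, Pi.add_apply, smul_eq_mul]
    ring
  have hy0 : y ≠ 0 := by
    rintro rfl
    exact h2 0 (by simp)
  have hyU : y ∉ Submodule.span ℂ {A *ᵥ y, A *ᵥ (A *ᵥ y) - c • y} := by
    intro h
    rw [Submodule.mem_span_pair] at h
    obtain ⟨a, b, h⟩ := h
    by_cases hb : b = 0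
    · subst hb
      rw [zero_smul, add_zero] at h
      have ha0 : a ≠ 0 := by rintro rfl; exact hy0 (by simpa using h.symm)
      apply h2 a⁻¹
      conv_rhs => rw [← h]
      rw [smul_smul, inv_mul_cancel₀ ha0, one_smul]
    · apply h4 (a / b) (-c - 1 / b)
      ext i
      have := congrFun h i
      simp only [Pi.sub_apply, Pi.smul_apply, Pi.add_apply, smul_eq_mul, Pi.zero_apply] at this ⊢
      field_simp
      linear_combination this
  obtain ⟨φ, g1, g2, g3, g4, g5⟩ := layer_sel A hA y (A *ᵥ (A *ᵥ y) - c • y) h2 hyU (by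
      intro h
      apply hyU
      have h5 := Submodule.sub_mem _ h (Submodule.subset_span (by simp : A *ᵥ (A *ᵥ y) - c • y ∈ ({A *ᵥ y, A *ᵥ (A *ᵥ y) - c • y} : Set _)))
      rw [sub_sub_cancel] at h5
      have h6 := Submodule.smul_mem _ c⁻¹ h5
      rwa [smul_smul, inv_mul_cancel₀ hc, one_smul] at h6)
  obtain ⟨P, p, p', A', k1, k2, k3, k4⟩ := layer_core2 A hA _ y φ rfl g1 g3 g4 h1 g5
  have hcc : φ (A *ᵥ (A *ᵥ y)) / φ y = c := by
    rw [map_sub, map_smul, sub_eq_zero, smul_eq_mul] at g2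
    rw [g2]; field_simp
  rw [hcc] at k1 k4
  refine ⟨P, p, p', A', k1, k2, k3, ?_⟩
  intro h
  have := k4 h
  apply h4 (-P) (-c)
  rw [this]
  ext i
  simp only [Pi.sub_apply, Pi.smul_apply, Pi.add_apply, smul_eq_mul, Pi.zero_apply]
  ring

def PT {ι : Type} [Fintype ι] [DecidableEq ι] (A B : Matrix ι ι ℂ) : Prop :=
  ∀ Z : Matrix ι ι ℂ, Z * A = A * Z → Z * B = B * Z → ∃ c : ℂ, Z = c • (1 : Matrix ι ι ℂ)

theorem rev_form {m : ℕ} {Q c κ : ℂ} {q q' : Fin m → ℂ} {B' B'' : Matrix (Fin m) (Fin m) ℂ}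
    (h : Sim B'' B') (hκ : κ ≠ 0) :
    ∃ (q1 q2 : Fin m → ℂ), Sim (M3 0 0 (c / κ) 0 B'' q1 κ q2 Q) (M3 Q q 1 q' B' 0 c 0 0) := by
  obtain ⟨R, R', h1, h2, h3⟩ := h
  refine ⟨κ⁻¹ • (R *ᵥ q'), (κ • q) ᵥ* R', M3 0 0 1 0 R 0 κ 0 0, M3 0 0 κ⁻¹ 0 R' 0 1 0 0, ?_, ?_, ?_⟩
  · rw [M3_mul, M3_one]; simp [h1, hκ]
  · rw [M3_mul, M3_one]; simp [h2, hκ]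
  · rw [M3_mul, M3_mul]
    simp only [zero_mul, zero_dotProduct, one_mul, zero_smul, zero_vecMul, one_smul, zero_add, smul_zero,
      vecMulVec_zero, zero_vecMulVec, add_zero, mul_zero, dotProduct_zero, mulVec_zero, mul_one, ← h3, smul_smul]
    congr 1
    rw [mul_right_comm, mul_inv_cancel₀ hκ, one_mul]

theorem M3_ex {ι : Type} [Fintype ι] [DecidableEq ι] (Z : Matrix (I3 ι) (I3 ι) ℂ) : ∃ (a : ℂ) (b : ι → ℂ) (c : ℂ) (d : ι → ℂ) (E : Matrix ι ι ℂ)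
    (f : ι → ℂ) (g : ℂ) (h : ι → ℂ) (i : ℂ), Z = M3 a b c d E f g h i := ⟨_, _, _, _, _, _, _, _, _, M3_eta Z⟩

theorem inj_of_not_ev {ι : Type} [Fintype ι] [DecidableEq ι] {M : Matrix ι ι ℂ} {μ : ℂ} (h : gm M μ = 0)
    {v : ι → ℂ} (hv : M *ᵥ v = μ • v) : v = 0 := by
  by_contra h0
  have := (gm_pos_iff M μ).2 ⟨v, h0, hv⟩
  omega

theorem inj_of_not_ev' {ι : Type} [Fintype ι] [DecidableEq ι] {M : Matrix ι ι ℂ} {μ : ℂ} (h : gm M μ = 0)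
    {v : ι → ℂ} (hv : v ᵥ* M = μ • v) : v = 0 := by
  by_contra h0
  have h1 : (M - μ • (1 : Matrix ι ι ℂ)).det = 0 := by
    rw [← Matrix.exists_vecMul_eq_zero_iff]
    refine ⟨v, h0, ?_⟩
    rw [Matrix.vecMul_sub, hv, Matrix.vecMul_smul, Matrix.vecMul_one, sub_self]
  rw [det_sub_eq_zero_iff] at h1
  omega

theorem M3_cent {m : ℕ} {P Q cA d κ : ℂ} {p p' q1 q2 : Fin m → ℂ} {A' B' : Matrix (Fin m) (Fin m) ℂ}
    (hA' : IsUnit A') (hc : cA ≠ 0) (hne : κ ≠ cA * d) (h1 : gm (A' * B') κ = 0)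
    (h2 : gm (A' * B') (cA * d) = 0)
    (hcent : ∀ (W : Matrix (Fin m) (Fin m) ℂ) (z : ℂ), W * A' = A' * W → W * B' = B' * W → W *ᵥ p' = z • p' →
      W = z • (1 : Matrix _ _ ℂ)) :
    PT (M3 P p 1 p' A' 0 cA 0 0) (M3 0 0 d 0 B' q1 κ q2 Q) := by
  intro Z hZA hZB
  have hN : Z * (M3 P p 1 p' A' 0 cA 0 0 * M3 0 0 d 0 B' q1 κ q2 Q) = (M3 P p 1 p' A' 0 cA 0 0 * M3 0 0 d 0 B' q1 κ q2 Q) * Z := by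
    rw [← Matrix.mul_assoc, hZA, Matrix.mul_assoc, hZB, Matrix.mul_assoc]
  rw [M3_mul] at hN
  obtain ⟨z11, z12, z13, z21, W, z23, z31, z32, z33, rfl⟩ := M3_ex Z
  rw [M3_mul, M3_mul] at hN hZA hZB
  simp only [mul_zero, dotProduct_zero, add_zero, zero_add, zero_mul, zero_dotProduct, smul_zero, mulVec_zero,
    zero_vecMul, zero_smul, one_mul, mul_one, one_smul, vecMulVec_zero, zero_vecMulVec, vecMul_zero] at hN hZA hZB
  obtain ⟨n11, n12, n13, n21, n22, n23, n31, n32, n33⟩ := M3_inj hN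
  have e31 : z31 = 0 := by
    have : (κ - cA * d) * z31 = 0 := by linear_combination n31
    exact (mul_eq_zero.1 this).resolve_left (sub_ne_zero.2 hne)
  subst e31
  simp only [zero_smul, add_zero, zero_add, zero_mul, mul_zero, smul_zero] at *
  have e21 : z21 = 0 := inj_of_not_ev h1 n21.symm
  have e32 : z32 = 0 := inj_of_not_ev' h2 (by
    simpa using n32)
  subst e21 e32
  obtain ⟨a11, a12, a13, a21, a22, a23, a31, a32, a33⟩ := M3_inj hZA
  obtain ⟨b11, b12, b13, b21, b22, b23, b31, b32, b33⟩ := M3_inj hZB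
  simp only [zero_smul, add_zero, zero_add, zero_mul, mul_zero, smul_zero, vecMulVec_zero, zero_vecMulVec, mulVec_zero,
    dotProduct_zero, zero_dotProduct, vecMul_zero, zero_vecMul] at *
  have e12 : z12 = 0 := (smul_eq_zero.1 a32.symm).resolve_left hc
  have e13 : z13 = 0 := (mul_eq_zero.1 a33.symm).resolve_left hc
  have e33 : z33 = z11 := mul_left_cancel₀ hc (by linear_combination a31)
  subst e12 e13 e33
  simp only [zero_smul, add_zero, zero_add, zero_mul, mul_zero, smul_zero, vecMulVec_zero, zero_vecMulVec, mulVec_zero,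
    dotProduct_zero, zero_dotProduct, vecMul_zero, zero_vecMul] at *
  have e23 : z23 = 0 := unit_inj hA' (by rw [← a23, mulVec_zero])
  subst e23
  simp only [zero_smul, add_zero, zero_add, zero_mul, mul_zero, smul_zero, vecMulVec_zero, zero_vecMulVec, mulVec_zero,
    dotProduct_zero, zero_dotProduct, vecMul_zero, zero_vecMul] at *
  have := hcent W z33 a22 b22 a21
  refine ⟨z33, ?_⟩
  rw [M3_one, M3_smul, this]
  simp

theorem combine {m : ℕ} {A B : Matrix (Fin (m+2)) (Fin (m+2)) ℂ} {P Q cA cB κ : ℂ} {p p' q q' : Fin m → ℂ}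
    {A' B' B'' : Matrix (Fin m) (Fin m) ℂ} (hA : Sim A (M3 P p 1 p' A' 0 cA 0 0))
    (hB : Sim B (M3 Q q 1 q' B' 0 cB 0 0)) (h : Sim B'' B') (hκ : κ ≠ 0) :
    ∃ B₂ : Matrix (Fin (m+2)) (Fin (m+2)) ℂ, Sim B₂ B ∧
      (∃ u v w, Sim (A * B₂) (M3 κ u v 0 (A' * B'') w 0 0 (cA * (cB / κ)))) ∧
      (IsUnit A' → cA ≠ 0 → κ ≠ cA * (cB / κ) → gm (A' * B'') κ = 0 → gm (A' * B'') (cA * (cB / κ)) = 0 →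
        (∀ (W : Matrix (Fin m) (Fin m) ℂ) (z : ℂ), W * A' = A' * W → W * B'' = B'' * W → W *ᵥ p' = z • p' →
          W = z • (1 : Matrix _ _ ℂ)) → PT A B₂) := by
  obtain ⟨q1, q2, hrev⟩ := rev_form (Q := Q) (c := cB) (q := q) (q' := q') h hκ
  obtain ⟨S, S', h1, h2, h3⟩ := hA
  have hB2 : Sim (S * M3 0 0 (cB / κ) 0 B'' q1 κ q2 Q * S') (M3 0 0 (cB / κ) 0 B'' q1 κ q2 Q) := ⟨S, S', h1, h2, rfl⟩
  refine ⟨S * M3 0 0 (cB / κ) 0 B'' q1 κ q2 Q * S', hB2.trans (hrev.trans hB.symm), ?_, ?_⟩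
  · refine ⟨p ᵥ* B'' + q2, P * (cB / κ) + p ⬝ᵥ q1 + Q, (cB / κ) • p' + A' *ᵥ q1, S, S', h1, h2, ?_⟩
    have e : M3 P p 1 p' A' 0 cA 0 0 * M3 0 0 (cB / κ) 0 B'' q1 κ q2 Q =
        M3 κ (p ᵥ* B'' + q2) (P * (cB / κ) + p ⬝ᵥ q1 + Q) 0 (A' * B'') ((cB / κ) • p' + A' *ᵥ q1) 0 0 (cA * (cB / κ)) := by
      rw [M3_mul]; simp
    rw [← e, h3]
    calc _ = S * M3 P p 1 p' A' 0 cA 0 0 * (S' * S) * M3 0 0 (cB / κ) 0 B'' q1 κ q2 Q * S' := by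
            simp only [Matrix.mul_assoc]
      _ = _ := by rw [h2]; simp only [Matrix.mul_assoc, Matrix.one_mul]
  · intro g1 g2 g3 g4 g5 g6 Z hZA hZB
    have key : ∀ X, Z * (S * X * S') = S * X * S' * Z → (S' * Z * S) * X = X * (S' * Z * S) := by
      intro X hX
      calc S' * Z * S * X = S' * (Z * (S * X * S')) * S := by
            simp only [Matrix.mul_assoc, h2, Matrix.mul_one]
        _ = (S' * S) * X * (S' * Z * S) := by rw [hX]; simp only [Matrix.mul_assoc]
        _ = _ := by rw [h2, Matrix.one_mul]
    rw [h3] at hZA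
    obtain ⟨c, hc⟩ := M3_cent (P := P) (p := p) (Q := Q) (q1 := q1) (q2 := q2) g1 g2 g3 g4 g5 g6 (S' * Z * S) (key _ hZA) (key _ hZB)
    refine ⟨c, ?_⟩
    calc Z = (S * S') * Z * (S * S') := by rw [h1]; simp
      _ = S * (S' * Z * S) * S' := by simp only [Matrix.mul_assoc]
      _ = _ := by rw [hc]; simp [h1]

theorem det_layers {m : ℕ} {A B : Matrix (Fin (m+2)) (Fin (m+2)) ℂ} {P Q cA cB : ℂ} {p p' q q' : Fin m → ℂ}
    {A' B' : Matrix (Fin m) (Fin m) ℂ} (hA : Sim A (M3 P p 1 p' A' 0 cA 0 0))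
    (hB : Sim B (M3 Q q 1 q' B' 0 cB 0 0)) : A.det * B.det = cA * cB * (A'.det * B'.det) := by
  obtain ⟨B₂, h1, ⟨u, v, w, h2⟩, -⟩ := combine hA hB (Sim.refl B') one_ne_zero
  rw [← h1.det, ← Matrix.det_mul, h2.det, M3_upper_det, Matrix.det_mul, div_one]; ring

section
variable {ι : Type} [Fintype ι] [DecidableEq ι]

theorem M3_gm {a : ℂ} {b : ι → ℂ} {c : ℂ} {E : Matrix ι ι ℂ} {f : ι → ℂ} {i : ℂ} (hai : a ≠ i)
    (ha : gm E a = 0) (hi : gm E i = 0) (μ : ℂ) :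
    gm (M3 a b c 0 E f 0 0 i) μ ≤ 1 ∨ gm (M3 a b c 0 E f 0 0 i) μ ≤ gm E μ := by
  set N := M3 a b c 0 E f 0 0 i with hN
  have key : ∀ v : I3 ι → ℂ, v ∈ LinearMap.ker (N - μ • (1 : Matrix _ _ ℂ)).mulVecLin →
      a * v (.inl ()) + b ⬝ᵥ (fun j => v (.inr (.inl j))) + c * v (.inr (.inr ())) = μ * v (.inl ()) ∧
      E *ᵥ (fun j => v (.inr (.inl j))) + v (.inr (.inr ())) • f = μ • (fun j => v (.inr (.inl j))) ∧
      i * v (.inr (.inr ())) = μ * v (.inr (.inr ())) := by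
    intro v hv
    rw [mem_ker_sub] at hv
    refine ⟨?_, ?_, ?_⟩
    · have := congrFun hv (.inl ())
      simp [hN, M3, mulVec, dotProduct, Fintype.sum_sum_type] at this
      simp only [dotProduct]
      linear_combination this
    · ext k
      have := congrFun hv (.inr (.inl k))
      simp [hN, M3, mulVec, dotProduct, Fintype.sum_sum_type] at this
      simp [mulVec, dotProduct]
      linear_combination this
    · have := congrFun hv (.inr (.inr ()))
      simpa [hN, M3, mulVec, dotProduct, Fintype.sum_sum_type] using this
  have hext : ∀ v : I3 ι → ℂ, v (.inl ()) = 0 → (fun j => v (.inr (.inl j))) = 0 → v (.inr (.inr ())) = 0 → v = 0 := by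
    intro v h1 h2 h3
    ext k
    rcases k with ⟨⟩ | k | ⟨⟩
    · exact h1
    · exact congrFun h2 k
    · exact h3
  have hcoord : ∀ k : I3 ι, (∀ v, v ∈ LinearMap.ker (N - μ • (1 : Matrix _ _ ℂ)).mulVecLin → v k = 0 → v = 0) → gm N μ ≤ 1 := by
    intro k hk
    let F : (LinearMap.ker (N - μ • (1 : Matrix _ _ ℂ)).mulVecLin) →ₗ[ℂ] ℂ :=
      (LinearMap.proj k) ∘ₗ Submodule.subtype _
    have hF : Function.Injective F := by
      rw [injective_iff_map_eq_zero]
      rintro ⟨u, hu⟩ h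
      exact Subtype.ext (hk u hu h)
    have := LinearMap.finrank_le_finrank_of_injective hF
    rwa [Module.finrank_self] at this
  by_cases h1 : μ = i
  · left
    refine hcoord (.inr (.inr ())) ?_
    intro v hv h3
    obtain ⟨e1, e2, e3⟩ := key v hv
    rw [h3, zero_smul, add_zero, h1] at e2
    have h2 := inj_of_not_ev hi e2
    rw [h2, h3, dotProduct_zero, h1] at e1
    refine hext v ?_ h2 h3
    have : (a - i) * v (.inl ()) = 0 := by linear_combination e1
    exact (mul_eq_zero.1 this).resolve_left (sub_ne_zero.2 hai)
  · have h3 : ∀ v, v ∈ LinearMap.ker (N - μ • (1 : Matrix _ _ ℂ)).mulVecLin → v (.inr (.inr ())) = 0 := by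
      intro v hv
      obtain ⟨e1, e2, e3⟩ := key v hv
      have : (i - μ) * v (.inr (.inr ())) = 0 := by linear_combination e3
      exact (mul_eq_zero.1 this).resolve_left (sub_ne_zero.2 (Ne.symm h1))
    by_cases h2 : μ = a
    · left
      refine hcoord (.inl ()) ?_
      intro v hv h4
      obtain ⟨e1, e2, e3⟩ := key v hv
      rw [h3 v hv, zero_smul, add_zero, h2] at e2
      exact hext v h4 (inj_of_not_ev ha e2) (h3 v hv)
    · right
      let F : (I3 ι → ℂ) →ₗ[ℂ] (ι → ℂ) := LinearMap.funLeft ℂ ℂ (fun j => (.inr (.inl j)))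
      have hF : ∀ v ∈ LinearMap.ker (N - μ • (1 : Matrix _ _ ℂ)).mulVecLin, F v ∈ LinearMap.ker (E - μ • (1 : Matrix _ _ ℂ)).mulVecLin := by
        intro v hv
        obtain ⟨e1, e2, e3⟩ := key v hv
        rw [h3 v hv, zero_smul, add_zero] at e2
        exact (mem_ker_sub _ _ _).2 e2
      refine LinearMap.finrank_le_finrank_of_injective (f := F.restrict hF) ?_
      rw [injective_iff_map_eq_zero]
      rintro ⟨v, hv⟩ h
      have h' : (fun j => v (.inr (.inl j))) = 0 := congrArg Subtype.val h
      obtain ⟨e1, e2, e3⟩ := key v hv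
      rw [h', h3 v hv, dotProduct_zero] at e1
      refine Subtype.ext (hext v ?_ h' (h3 v hv))
      have : (a - μ) * v (.inl ()) = 0 := by linear_combination e1
      exact (mul_eq_zero.1 this).resolve_left (sub_ne_zero.2 (Ne.symm h2))

theorem quad_ev {A : Matrix ι ι ℂ} {β γ : ℂ} (h : (A - β • (1 : Matrix ι ι ℂ)) * (A - γ • (1 : Matrix ι ι ℂ)) = 0)
    {μ : ℂ} (hμ : 0 < gm A μ) : μ = β ∨ μ = γ := by
  obtain ⟨v, hv, hv2⟩ := (gm_pos_iff _ _).1 hμ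
  have := congrArg (fun M => M *ᵥ v) h
  simp only [← Matrix.mulVec_mulVec, Matrix.sub_mulVec, Matrix.smul_mulVec, Matrix.one_mulVec, hv2, ← sub_smul, Matrix.mulVec_smul, Matrix.zero_mulVec, smul_smul, smul_eq_zero, mul_eq_zero, sub_eq_zero, hv, or_false] at this
  tauto

theorem not_quad_of_three {A : Matrix ι ι ℂ} {a b c : ℂ} (hab : a ≠ b) (hac : a ≠ c) (hbc : b ≠ c)
    (ha : A.charpoly.eval a = 0) (hb : A.charpoly.eval b = 0) (hc : A.charpoly.eval c = 0) : ¬ Quad A := by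
  rintro ⟨β, γ, h⟩
  have h1 := quad_ev h ((charpoly_eval_iff A a).1 ha)
  have h2 := quad_ev h ((charpoly_eval_iff A b).1 hb)
  have h3 := quad_ev h ((charpoly_eval_iff A c).1 hc)
  grind
end

theorem choose_kappa (F : Set ℂ) (hF : F.Finite) (a b : ℂ) (ha : a ≠ 0) (hb : b ≠ 0) :
    ∃ κ : ℂ, κ ≠ 0 ∧ κ ≠ a * (b / κ) ∧ κ ∉ F ∧ a * (b / κ) ∉ F := by
  obtain ⟨s, hs⟩ := IsAlgClosed.exists_eq_mul_self (a * b)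
  have hfin : ({0, s, -s} ∪ F ∪ (fun f => a * b / f) '' F).Finite :=
    ((Set.toFinite _).union hF).union (hF.image _)
  obtain ⟨κ, hκ⟩ := hfin.exists_notMem
  simp only [Set.mem_union, Set.mem_insert_iff, Set.mem_singleton_iff, Set.mem_image, not_or, not_exists, not_and] at hκ
  obtain ⟨⟨⟨h0, h1, h2⟩, h3⟩, h4⟩ := hκ
  refine ⟨κ, h0, ?_, h3, ?_⟩
  · intro h
    have : (κ - s) * (κ + s) = 0 := by
      have h' : κ * κ = a * b := by
        calc κ * κ = a * (b / κ) * κ := by rw [← h]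
          _ = a * b := by field_simp
      linear_combination h' + hs
    rcases mul_eq_zero.1 this with h | h
    · exact h1 (sub_eq_zero.1 h)
    · exact h2 (eq_neg_of_add_eq_zero_left h)
  · intro h
    apply h4 _ h
    field_simp

theorem gm_smul {ι : Type} [Fintype ι] [DecidableEq ι] (B : Matrix ι ι ℂ) {β : ℂ} (hβ : β ≠ 0) (μ : ℂ) :
    gm (β • B) μ = gm B (μ / β) := by
  have : LinearMap.ker (β • B - μ • (1 : Matrix ι ι ℂ)).mulVecLin = LinearMap.ker (B - (μ / β) • (1 : Matrix ι ι ℂ)).mulVecLin := by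
    ext v
    rw [mem_ker_sub, mem_ker_sub, Matrix.smul_mulVec, div_eq_inv_mul, ← smul_smul, eq_inv_smul_iff₀ hβ]
  rw [gm, gm, this]

theorem scal_ne_zero {n : ℕ} (hn : 0 < n) {β : ℂ} (h : IsUnit (β • (1 : Matrix (Fin n) (Fin n) ℂ))) : β ≠ 0 := by
  haveI : Nonempty (Fin n) := ⟨⟨0, hn⟩⟩
  rintro rfl
  rw [zero_smul] at h
  exact not_isUnit_zero h

theorem scal_small {n : ℕ} (hn : n ≤ 1) (A : Matrix (Fin n) (Fin n) ℂ) : Scal A := by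
  haveI : Subsingleton (Fin n) := Fin.subsingleton_iff_le_one.2 hn
  by_cases h : Nonempty (Fin n)
  · obtain ⟨i⟩ := h
    refine ⟨A i i, ?_⟩
    ext a b
    rw [Subsingleton.elim a i, Subsingleton.elim b i]; simp
  · exact ⟨0, by ext a; exact absurd ⟨a⟩ h⟩

theorem gm_lt_of_not_scal {n : ℕ} {A : Matrix (Fin n) (Fin n) ℂ} (h : ¬ Scal A) (μ : ℂ) : gm A μ < n := by
  by_contra hc
  exact h ⟨μ, scal_of_gm (by rw [Fintype.card_fin]; omega)⟩

theorem merge : ∀ (n : ℕ) (A B : Matrix (Fin n) (Fin n) ℂ), IsUnit A → IsUnit B → ∀ a b : ℕ, (∀ μ, gm A μ ≤ a) →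
    (∀ μ, gm B μ ≤ b) → ∃ B₂, Sim B₂ B ∧ (∀ μ, gm (A * B₂) μ ≤ 1 ∨ gm (A * B₂) μ + n ≤ a + b) ∧
      (3 ≤ n → ¬ Scal A → ¬ Scal B → ¬ Quad (A * B₂)) := by
  intro n
  induction n using Nat.strong_induction_on with
  | _ n ih =>
  intro A B hA hB a b ha hb
  by_cases hn0 : n = 0
  · subst hn0
    refine ⟨B, Sim.refl B, fun μ => Or.inl ?_, by omega⟩
    have := gm_le_card (A * B) μ
    rw [Fintype.card_fin] at this; omega
  by_cases hsA : Scal A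
  · refine ⟨B, Sim.refl B, fun μ => Or.inr ?_, fun _ h => absurd hsA h⟩
    obtain ⟨β, rfl⟩ := hsA
    have hβ := scal_ne_zero (by omega) hA
    rw [Matrix.smul_mul, Matrix.one_mul, gm_smul _ hβ]
    have h1 := ha β
    have h2 := hb (μ / β)
    rw [gm_scal, if_pos rfl, Fintype.card_fin] at h1
    omega
  by_cases hsB : Scal B
  · refine ⟨B, Sim.refl B, fun μ => Or.inr ?_, fun _ _ h => absurd hsB h⟩
    obtain ⟨β, rfl⟩ := hsB
    have hβ := scal_ne_zero (by omega) hB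
    rw [Matrix.mul_smul, Matrix.mul_one, gm_smul _ hβ]
    have h1 := hb β
    have h2 := ha (μ / β)
    rw [gm_scal, if_pos rfl, Fintype.card_fin] at h1
    omega
  have hn2 : 2 ≤ n := by
    by_contra h
    exact hsA (scal_small (by omega) A)
  obtain ⟨m, rfl⟩ : ∃ m, n = m + 2 := ⟨n - 2, by omega⟩
  have ha' := gm_lt_of_not_scal hsA
  have hb' := gm_lt_of_not_scal hsB
  obtain ⟨μA, hμA⟩ := exists_gm_pos A
  obtain ⟨μB, hμB⟩ := exists_gm_pos B
  obtain ⟨cA, P, p, p', A', hcA, hSA, hA', hgA⟩ := layer_gen A hA hsA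
  obtain ⟨cB, Q, q, q', B', hcB, hSB, hB', hgB⟩ := layer_gen B hB hsB
  obtain ⟨B'', hB'', hg, -⟩ := ih m (by omega) A' B' hA' hB' (max 1 (min a (m+1) - 1)) (max 1 (min b (m+1) - 1))
    (by intro μ; have := hgA μ; have := ha μ; have := ha' μ; omega)
    (by intro μ; have := hgB μ; have := hb μ; have := hb' μ; omega)
  obtain ⟨κ, hκ0, hκ1, hκ2, hκ3⟩ := choose_kappa {μ | 0 < gm (A' * B'') μ} (finite_gm _) cA cB hcA hcB
  obtain ⟨B₂, hB₂, ⟨u, v, w, hN⟩, -⟩ := combine hSA hSB hB'' hκ0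
  have hκ2' : gm (A' * B'') κ = 0 := by simpa using hκ2
  have hκ3' : gm (A' * B'') (cA * (cB / κ)) = 0 := by simpa using hκ3
  refine ⟨B₂, hB₂, ?_, ?_⟩
  · intro μ
    rw [hN.gm_eq]
    have h1 := M3_gm (b := u) (c := v) (f := w) hκ1 hκ2' hκ3' μ
    have h2 := hg μ
    have h3 := gm_le_card (A' * B'') μ
    have := ha μA
    have := hb μB
    have := ha' μA
    have := hb' μB
    rw [Fintype.card_fin] at h3
    omega
  · intro hm _ _
    haveI : Nonempty (Fin m) := ⟨⟨0, by omega⟩⟩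
    obtain ⟨ν, hν⟩ := exists_gm_pos (A' * B'')
    have hc := hN.charpoly
    rw [M3_upper_charpoly] at hc
    refine not_quad_of_three (a := κ) (b := cA * (cB / κ)) (c := ν) hκ1 ?_ ?_ ?_ ?_ ?_
    · rintro rfl; omega
    · rintro rfl; omega
    · rw [hc]; simp
    · rw [hc]; simp
    · rw [hc]; simp [(charpoly_eval_iff (A' * B'') ν).2 hν]

theorem ker_mul_le {ι : Type} [Fintype ι] [DecidableEq ι] (M N : Matrix ι ι ℂ) :
    Module.finrank ℂ (LinearMap.ker (M * N).mulVecLin) ≤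
      Module.finrank ℂ (LinearMap.ker M.mulVecLin) + Module.finrank ℂ (LinearMap.ker N.mulVecLin) := by
  have hr : ∀ v : LinearMap.ker (M * N).mulVecLin, N.mulVecLin v.1 ∈ LinearMap.ker M.mulVecLin := by
    rintro ⟨v, hv⟩
    simpa [LinearMap.mem_ker, Matrix.mulVec_mulVec] using hv
  let g : LinearMap.ker (M * N).mulVecLin →ₗ[ℂ] LinearMap.ker M.mulVecLin :=
    LinearMap.codRestrict _ (N.mulVecLin.comp (Submodule.subtype _)) hr
  have h := LinearMap.finrank_range_add_finrank_ker g
  have h1 : Module.finrank ℂ (LinearMap.range g) ≤ Module.finrank ℂ (LinearMap.ker M.mulVecLin) :=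
    Submodule.finrank_le _
  have h2 : Module.finrank ℂ (LinearMap.ker g) ≤ Module.finrank ℂ (LinearMap.ker N.mulVecLin) := by
    refine LinearMap.finrank_le_finrank_of_injective (f := LinearMap.codRestrict (LinearMap.ker N.mulVecLin)
      ((Submodule.subtype _).comp (Submodule.subtype (LinearMap.ker g))) ?_) ?_
    · rintro ⟨⟨v, hv⟩, hv'⟩
      have := congrArg Subtype.val (LinearMap.mem_ker.1 hv')
      exact LinearMap.mem_ker.2 this
    · intro a b hab
      have := congrArg Subtype.val hab
      simp only [LinearMap.codRestrict_apply, LinearMap.comp_apply, Submodule.subtype_apply] at this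
      exact Subtype.ext (Subtype.ext this)
  omega

theorem ker_aeval_le {ι : Type} [Fintype ι] [DecidableEq ι] (A : Matrix ι ι ℂ) (h : ∀ μ, gm A μ ≤ 1) :
    ∀ (k : ℕ) (f : ℂ[X]), f ≠ 0 → f.natDegree = k → Module.finrank ℂ (LinearMap.ker (aeval A f).mulVecLin) ≤ k := by
  intro k
  induction k with
  | zero =>
    intro f hf hd
    rw [Polynomial.natDegree_eq_zero] at hd
    obtain ⟨c, rfl⟩ := hd
    have hc : c ≠ 0 := by rintro rfl; simp at hf
    rw [Nat.le_zero, Submodule.finrank_eq_zero, Submodule.eq_bot_iff]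
    intro v hv
    rw [LinearMap.mem_ker, aeval_C, Matrix.mulVecLin_apply, Algebra.algebraMap_eq_smul_one, Matrix.smul_mulVec,
      Matrix.one_mulVec, smul_eq_zero] at hv
    exact hv.resolve_left hc
  | succ k ih =>
    intro f hf hd
    obtain ⟨μ, hμ⟩ := IsAlgClosed.exists_root f (by
      intro h0; rw [Polynomial.degree_eq_natDegree hf, hd] at h0; exact absurd h0 (by exact_mod_cast Nat.succ_ne_zero k))
    obtain ⟨g, rfl⟩ := Polynomial.dvd_iff_isRoot.2 hμ
    have hg : g ≠ 0 := by rintro rfl; simp at hf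
    rw [Polynomial.natDegree_mul (Polynomial.X_sub_C_ne_zero μ) hg, Polynomial.natDegree_X_sub_C] at hd
    have h1 := ih g hg (by omega)
    have h2 := ker_mul_le (A - μ • (1 : Matrix ι ι ℂ)) (aeval A g)
    have h3 := h μ
    rw [gm] at h3
    rw [map_mul, map_sub, aeval_X, aeval_C, Algebra.algebraMap_eq_smul_one]
    omega

/-- cyclic vector -/
theorem exists_cyclic {n : ℕ} (hn : 0 < n) (A : Matrix (Fin n) (Fin n) ℂ) (h : ∀ μ, gm A μ ≤ 1) :
    ∃ y : Fin n → ℂ, ∀ f : ℂ[X], f.natDegree < n → aeval A f *ᵥ y = 0 → f = 0 := by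
  classical
  have : Nonempty (Fin n) := ⟨⟨0, hn⟩⟩
  have hχ : A.charpoly ≠ 0 := A.charpoly_monic.ne_zero
  have hdeg : A.charpoly.natDegree = n := by rw [Matrix.charpoly_natDegree_eq_dim, Fintype.card_fin]
  have hfin : (A.charpoly.roots.toFinset : Set ℂ).Finite := Finset.finite_toSet _
  have hne : ∀ μ ∈ A.charpoly.roots.toFinset,
      LinearMap.ker (aeval A (A.charpoly /ₘ (X - C μ))).mulVecLin ≠ ⊤ := by
    intro μ hμ htop
    have hr : A.charpoly.IsRoot μ := by
      rw [Multiset.mem_toFinset, Polynomial.mem_roots hχ] at hμ; exact hμ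
    have h0 : A.charpoly /ₘ (X - C μ) ≠ 0 := by
      intro h0
      have := Polynomial.mul_divByMonic_eq_iff_isRoot.2 hr
      rw [h0, mul_zero] at this
      exact hχ this.symm
    have hd : (A.charpoly /ₘ (X - C μ)).natDegree = n - 1 := by
      rw [Polynomial.natDegree_divByMonic _ (Polynomial.monic_X_sub_C μ), hdeg, Polynomial.natDegree_X_sub_C]
    have := ker_aeval_le A h _ _ h0 hd
    rw [htop, finrank_top, Module.finrank_fintype_fun_eq_card, Fintype.card_fin] at this
    omega
  obtain ⟨y, hy⟩ := Submodule.exists_forall_notMem_of_forall_ne_top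
    (fun μ : {μ // μ ∈ A.charpoly.roots.toFinset} => LinearMap.ker (aeval A (A.charpoly /ₘ (X - C μ.1))).mulVecLin)
    (fun μ => hne μ.1 μ.2)
  refine ⟨y, fun f hf hfy => ?_⟩
  by_contra hf0
  obtain ⟨h', hh⟩ := EuclideanDomain.gcd_dvd_right f A.charpoly
  have hgf := EuclideanDomain.gcd_dvd_left f A.charpoly
  have hab := EuclideanDomain.gcd_eq_gcd_ab f A.charpoly
  have hg : aeval A (EuclideanDomain.gcd f A.charpoly) *ᵥ y = 0 := by
    rw [hab, mul_comm f, map_add, map_mul, map_mul, Matrix.aeval_self_charpoly, Matrix.zero_mul, add_zero,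
      ← Matrix.mulVec_mulVec, hfy, Matrix.mulVec_zero]
  generalize EuclideanDomain.gcd f A.charpoly = g at *
  have hg0 : g ≠ 0 := by rintro rfl; exact hf0 (zero_dvd_iff.1 hgf)
  have hdg := Polynomial.natDegree_le_of_dvd hgf hf0
  have hh0 : h' ≠ 0 := by rintro rfl; exact hχ (by rw [hh, mul_zero])
  have hdh : g.natDegree + h'.natDegree = n := by rw [← Polynomial.natDegree_mul hg0 hh0, ← hh, hdeg]
  obtain ⟨μ, hμ⟩ := IsAlgClosed.exists_root h' (by
      intro h0; rw [Polynomial.degree_eq_natDegree hh0] at h0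
      have : h'.natDegree = 0 := by exact_mod_cast h0
      omega)
  obtain ⟨k, rfl⟩ := Polynomial.dvd_iff_isRoot.2 hμ
  have hμ' : μ ∈ A.charpoly.roots.toFinset := by
    rw [Multiset.mem_toFinset, Polynomial.mem_roots hχ, Polynomial.IsRoot.def, hh]; simp
  apply hy ⟨μ, hμ'⟩
  have e : A.charpoly /ₘ (X - C μ) = k * g := by
    have : A.charpoly = (X - C μ) * (k * g) := by rw [hh]; ring
    rw [this, Polynomial.mul_divByMonic_cancel_left _ (Polynomial.monic_X_sub_C μ)]
  change _ ∈ LinearMap.ker _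
  rw [LinearMap.mem_ker, e, map_mul, Matrix.mulVecLin_apply, ← Matrix.mulVec_mulVec, hg, Matrix.mulVec_zero]

theorem aeval_eig {ι : Type} [Fintype ι] [DecidableEq ι] (A : Matrix ι ι ℂ) (f : ℂ[X]) {t : ℂ} {v : ι → ℂ}
    (h : A *ᵥ v = t • v) : aeval A f *ᵥ v = f.eval t • v := by
  induction f using Polynomial.induction_on' with
  | add p q hp hq => rw [map_add, Matrix.add_mulVec, hp, hq, eval_add, add_smul]
  | monomial k a =>
    have : ∀ k : ℕ, (A ^ k) *ᵥ v = t ^ k • v := by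
      intro k
      induction k with
      | zero => simp
      | succ k ih => rw [pow_succ, ← Matrix.mulVec_mulVec, h, Matrix.mulVec_smul, ih, smul_smul, pow_succ, mul_comm]
    rw [aeval_monomial, eval_monomial, Algebra.algebraMap_eq_smul_one, Matrix.smul_mul, Matrix.one_mul,
      Matrix.smul_mulVec, this, smul_smul]

theorem lev_K {n k : ℕ} {A : Matrix (Fin n) (Fin n) ℂ} {y : Fin n → ℂ}
    (hy : ∀ f : ℂ[X], f.natDegree < n → aeval A f *ᵥ y = 0 → f = 0) {t : Fin k → ℂ} (ht : Function.Injective t)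
    (ht0 : ∀ i, t i ≠ 0) {e : Fin k → Fin n → ℂ} {d : Fin k → ℂ} (he0 : ∀ i, e i ≠ 0)
    (he : ∀ i, A *ᵥ e i = t i • e i + d i • (A *ᵥ y)) (J : Finset (Fin k)) (α : Fin k → ℂ) (g : ℂ[X])
    (hJ : J.card + g.natDegree < n) (h : ∑ i ∈ J, α i • e i = aeval A g *ᵥ y) : g = 0 ∧ ∀ i ∈ J, α i = 0 := by
  classical
  let T : ℂ[X] := ∏ i ∈ J, (X - C (t i))
  let Ti : Fin k → ℂ[X] := fun i => ∏ j ∈ J.erase i, (X - C (t j))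
  have hT : ∀ i ∈ J, T = Ti i * (X - C (t i)) := fun i hi => (Finset.prod_erase_mul J _ hi).symm
  have hTd : T.natDegree = J.card := by
    simp only [T]; rw [Polynomial.natDegree_prod_of_monic _ _ (fun i _ => Polynomial.monic_X_sub_C _)]; simp
  have hTm : T.Monic := Polynomial.monic_prod_of_monic _ _ (fun i _ => Polynomial.monic_X_sub_C _)
  have hTid : ∀ i ∈ J, (Ti i).natDegree + 1 = J.card := by
    intro i hi
    simp only [Ti]; rw [Polynomial.natDegree_prod_of_monic _ _ (fun i _ => Polynomial.monic_X_sub_C _)]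
    simp only [natDegree_X_sub_C, Finset.sum_const, smul_eq_mul, mul_one]
    exact Finset.card_erase_add_one hi
  have hTi0 : ∀ i j, i ≠ j → j ∈ J → (Ti i).eval (t j) = 0 := by
    intro i j hij hj
    simp only [Ti]; rw [Polynomial.eval_prod]
    exact Finset.prod_eq_zero (Finset.mem_erase.2 ⟨Ne.symm hij, hj⟩) (by simp)
  have hTi1 : ∀ i, (Ti i).eval (t i) ≠ 0 := by
    intro i
    simp only [Ti]; rw [Polynomial.eval_prod]
    refine Finset.prod_ne_zero_iff.2 fun j hj => ?_
    rw [eval_sub, eval_X, eval_C, sub_ne_zero]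
    exact fun h => (Finset.mem_erase.1 hj).1 (ht h).symm
  have hTe : ∀ i ∈ J, aeval A T *ᵥ e i = aeval A (C (d i) * (Ti i * X)) *ᵥ y := by
    intro i hi
    rw [hT i hi, map_mul, map_mul, map_mul, ← Matrix.mulVec_mulVec, map_sub, aeval_X, aeval_C, aeval_C,
      Algebra.algebraMap_eq_smul_one, Algebra.algebraMap_eq_smul_one, Matrix.sub_mulVec, Matrix.smul_mulVec,
      Matrix.one_mulVec, he i, add_sub_cancel_left, Matrix.smul_mul, Matrix.one_mul, Matrix.smul_mulVec,
      Matrix.mulVec_smul, Matrix.mulVec_mulVec]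
  have h1 : (∑ i ∈ J, C (α i * d i) * (Ti i * X)) - T * g = 0 := by
    apply hy
    · refine lt_of_le_of_lt (Polynomial.natDegree_sub_le _ _) (max_lt ?_ ?_)
      · refine lt_of_le_of_lt (Polynomial.natDegree_sum_le_of_forall_le (n := J.card) J _ ?_) (by omega)
        intro i hi
        refine (Polynomial.natDegree_C_mul_le _ _).trans ((Polynomial.natDegree_mul_le).trans ?_)
        rw [natDegree_X, hTid i hi]
      · exact lt_of_le_of_lt Polynomial.natDegree_mul_le (by omega)
    · rw [map_sub, map_mul, Matrix.sub_mulVec, ← Matrix.mulVec_mulVec, ← h, sub_eq_zero, Matrix.mulVec_sum, map_sum,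
        Matrix.sum_mulVec]
      refine Finset.sum_congr rfl fun i hi => ?_
      rw [Matrix.mulVec_smul, hTe i hi, C_mul, mul_assoc, map_mul (aeval A) (C (α i)), aeval_C, Algebra.algebraMap_eq_smul_one,
        Matrix.smul_mul, Matrix.one_mul, Matrix.smul_mulVec]
  have h2 : ∀ i ∈ J, α i * d i = 0 := by
    intro i hi
    have := congrArg (Polynomial.eval (t i)) h1
    rw [eval_sub, eval_finsetSum, Finset.sum_eq_single_of_mem i hi, hT i hi] at this
    · simp only [eval_mul, eval_C, eval_X, eval_sub, sub_self, mul_zero, zero_mul, sub_zero, eval_zero] at this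
      rcases mul_eq_zero.1 this with h' | h'
      · exact h'
      · exact absurd h' (mul_ne_zero (hTi1 i) (ht0 i))
    · intro j hj hji
      rw [eval_mul, eval_mul, hTi0 j i hji hi]; simp
  have hg : g = 0 := by
    rw [Finset.sum_eq_zero, zero_sub, neg_eq_zero] at h1
    · exact (mul_eq_zero.1 h1).resolve_left hTm.ne_zero
    · intro i hi; rw [h2 i hi]; simp
  refine ⟨hg, fun i hi => ?_⟩
  rw [hg, map_zero, Matrix.zero_mulVec] at h
  have h3 := congrArg (fun v => aeval A (Ti i) *ᵥ v) h
  simp only [Matrix.mulVec_zero, Matrix.mulVec_sum] at h3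
  have h4 : ∀ j ∈ J, aeval A (Ti i) *ᵥ (α j • e j) = (Ti i).eval (t j) • (α j • e j) := by
    intro j hj
    apply aeval_eig
    rw [Matrix.mulVec_smul, he j, smul_add, smul_smul, smul_smul, smul_smul, h2 j hj, zero_smul, add_zero, mul_comm]
  rw [Finset.sum_congr rfl h4, Finset.sum_eq_single_of_mem i hi] at h3
  · rcases smul_eq_zero.1 h3 with h' | h'
    · exact absurd h' (hTi1 i)
    · exact (smul_eq_zero.1 h').resolve_right (he0 i)
  · intro j hj hji
    rw [hTi0 i j hji.symm hj, zero_smul]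

theorem levelt {m : ℕ} (A : Matrix (Fin (m+2)) (Fin (m+2)) ℂ) (hA : IsUnit A) (h : ∀ μ, gm A μ ≤ 1)
    (t : Fin m → ℂ) (ht : Function.Injective t) (ht0 : ∀ i, t i ≠ 0) :
    ∃ (c P : ℂ) (p p' : Fin m → ℂ), c ≠ 0 ∧ Sim A (M3 P p 1 p' (diagonal t) 0 c 0 0) ∧ ∀ i, p' i ≠ 0 := by
  classical
  obtain ⟨y, hy⟩ := exists_cyclic (by omega) A h
  have hy0 : y ≠ 0 := by
    rintro rfl
    exact one_ne_zero (hy 1 (by simp) (by simp))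
  have hex : ∀ i, ∃ (e : Fin (m+2) → ℂ) (d : ℂ), e ≠ 0 ∧ A *ᵥ e = t i • e + d • (A *ᵥ y) := by
    intro i
    by_cases hg : 0 < gm A (t i)
    · obtain ⟨v, hv, hv'⟩ := (gm_pos_iff _ _).1 hg
      exact ⟨v, 0, hv, by simp [hv']⟩
    · have hu : IsUnit (A - t i • (1 : Matrix (Fin (m+2)) (Fin (m+2)) ℂ)) := by
        rw [Matrix.isUnit_iff_isUnit_det, isUnit_iff_ne_zero]
        exact fun h0 => hg ((det_sub_eq_zero_iff _ _).1 h0)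
      obtain ⟨e, he⟩ := (Matrix.mulVec_surjective_iff_isUnit.2 hu) (A *ᵥ y)
      refine ⟨e, 1, ?_, ?_⟩
      · rintro rfl
        rw [Matrix.mulVec_zero] at he
        exact hy0 (unit_inj hA (by rw [← he, Matrix.mulVec_zero]))
      · rw [Matrix.sub_mulVec, Matrix.smul_mulVec, Matrix.one_mulVec] at he
        rw [one_smul, ← he]; abel
  choose e d he0 he using hex
  have K := lev_K hy ht ht0 he0 he
  have hCX : ∀ a b : ℂ, aeval A (C a * X + C b) *ᵥ y = a • (A *ᵥ y) + b • y := by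
    intro a b
    rw [map_add, map_mul, aeval_C, aeval_C, aeval_X, Algebra.algebraMap_eq_smul_one, Algebra.algebraMap_eq_smul_one,
      Matrix.add_mulVec, Matrix.smul_mul, Matrix.one_mul, Matrix.smul_mulVec, Matrix.smul_mulVec, Matrix.one_mulVec]
  have hind : ∀ (α : Fin m → ℂ) (a b : ℂ), ∑ i, α i • e i = a • (A *ᵥ y) + b • y → (∀ i, α i = 0) ∧ a = 0 ∧ b = 0 := by
    intro α a b hab
    obtain ⟨h1, h2⟩ := K Finset.univ α (C a * X + C b) (by
      have : (C a * X + C b).natDegree ≤ 1 := by compute_degree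
      rw [Finset.card_univ, Fintype.card_fin]; omega) (by rw [hCX, hab])
    refine ⟨fun i => h2 i (Finset.mem_univ i), ?_, ?_⟩
    · simpa using congrArg (fun f => f.coeff 1) h1
    · simpa using congrArg (fun f => f.coeff 0) h1
  let b : Fin m ⊕ Bool → (Fin (m+2) → ℂ) := Sum.elim e (fun z => if z then A *ᵥ y else y)
  have hb : LinearIndependent ℂ b := by
    rw [Fintype.linearIndependent_iff]
    intro g hg
    rw [Fintype.sum_sum_type, Fintype.sum_bool] at hg
    simp only [b, Sum.elim_inl, Sum.elim_inr, if_true, Bool.false_eq_true, if_false] at hg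
    obtain ⟨h1, h2, h3⟩ := hind (fun i => g (.inl i)) (- g (.inr true)) (- g (.inr false)) (by
      rw [eq_comm, ← sub_eq_zero, ← neg_eq_zero, ← hg]; module)
    rintro (i | (_ | _))
    · exact h1 i
    · simpa using h3
    · simpa using h2
  let bs := basisOfLinearIndependentOfCardEqFinrank hb (by simp)
  have hbs : ∀ i, bs i = b i := fun i => by simp [bs]
  let φ := bs.coord (.inr false)
  have hφ : ∀ i, φ (b i) = if i = .inr false then 1 else 0 := by
    intro i
    simp only [φ, ← hbs, Module.Basis.coord_apply, Module.Basis.repr_self, Finsupp.single_apply]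
  have hφx : φ (A *ᵥ y) = 0 := by have := hφ (.inr true); simpa [b] using this
  have hφy : φ y = 1 := by have := hφ (.inr false); simpa [b] using this
  have hφe : ∀ i, φ (e i) = 0 := by intro i; have := hφ (.inl i); simpa [b] using this
  have hφAe : ∀ i, φ (A *ᵥ e i) = 0 := by
    intro i; rw [he, map_add, map_smul, map_smul, hφe, hφx]; simp
  have hφAx : φ (A *ᵥ (A *ᵥ y)) ≠ 0 := by
    intro h0
    have hz : φ.comp A.mulVecLin = 0 := by
      refine bs.ext ?_
      rintro (i | (_ | _)) <;> rw [hbs]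
      · simpa [b] using hφAe i
      · simpa [b] using hφx
      · simpa [b] using h0
    obtain ⟨w, hw⟩ := (Matrix.mulVec_surjective_iff_isUnit.2 hA) y
    have := LinearMap.congr_fun hz w
    rw [LinearMap.comp_apply, Matrix.mulVecLin_apply, hw, hφy] at this
    exact one_ne_zero this
  have hei : LinearIndependent ℂ e := hb.comp Sum.inl Sum.inl_injective
  obtain ⟨P, p, p', A', hS, h1, h2⟩ := layer_core A (A *ᵥ y) y φ rfl hφx (by rw [hφy]; exact one_ne_zero) hφAx e hei hφe hφAe
  have hA' : A' = diagonal t := by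
    ext i j
    have h3 := h1 j
    rw [he] at h3
    obtain ⟨h4, -, -⟩ := hind (fun i => A' i j - (if i = j then t j else 0)) (d j - p j) 0 (by
      simp only [sub_smul, Finset.sum_sub_distrib, ite_smul, zero_smul, Finset.sum_ite_eq', Finset.mem_univ, if_true, add_zero]
      rw [sub_eq_sub_iff_add_eq_add]
      refine (add_comm _ _).trans (h3.symm.trans (add_comm _ _)))
    have h5 := sub_eq_zero.1 (h4 i)
    rw [h5, Matrix.diagonal_apply]
    split_ifs with h6
    · rw [h6]
    · rfl
  rw [hA'] at hS
  refine ⟨_, P, p, p', div_ne_zero hφAx (by rw [hφy]; exact one_ne_zero), hS, ?_⟩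
  intro i hi
  rw [hφy, div_one] at h2
  generalize φ (A *ᵥ (A *ᵥ y)) = c at *
  have hg := (K (Finset.univ.erase i) p' (X ^ 2 - (C P * X + C c)) (by
    have : (X ^ 2 - (C P * X + C c)).natDegree ≤ 2 := by compute_degree
    have h7 := Finset.card_erase_add_one (Finset.mem_univ i)
    rw [Finset.card_univ, Fintype.card_fin] at h7
    omega) (by
    rw [map_sub, Matrix.sub_mulVec, hCX, map_pow, aeval_X, pow_two, ← Matrix.mulVec_mulVec, h2,
      ← Finset.sum_erase_add _ _ (Finset.mem_univ i), hi]
    module)).1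
  have := congrArg (fun f => f.coeff 2) hg
  simp [Polynomial.coeff_X, Polynomial.coeff_C] at this

def Goal2 {n : ℕ} (A B : Matrix (Fin n) (Fin n) ℂ) (s : Finset ℂ) : Prop :=
  ∃ B₂, Sim B₂ B ∧ (A * B₂).charpoly = ∏ z ∈ s, (X - C z) ∧ PT A B₂

theorem Goal2.swap {n : ℕ} {A B : Matrix (Fin n) (Fin n) ℂ} {s : Finset ℂ} (h : Goal2 B A s) : Goal2 A B s := by
  obtain ⟨A₂, ⟨S, S', h1, h2, h3⟩, h4, h5⟩ := h
  have hA : A = S' * A₂ * S := by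
    rw [h3]
    calc A = (S' * S) * A * (S' * S) := by rw [h2, Matrix.one_mul, Matrix.mul_one]
      _ = _ := by simp only [Matrix.mul_assoc]
  refine ⟨S' * B * S, ⟨S', S, h2, h1, rfl⟩, ?_, ?_⟩
  · rw [← h4, Matrix.charpoly_mul_comm B A₂]
    refine Sim.charpoly ⟨S', S, h2, h1, ?_⟩
    rw [hA]
    calc _ = S' * A₂ * (S * S') * B * S := by simp only [Matrix.mul_assoc]
      _ = _ := by rw [h1, Matrix.mul_one]; simp only [Matrix.mul_assoc]
  · intro Z hZA hZB
    have key : ∀ Y : Matrix (Fin n) (Fin n) ℂ, Z * (S' * Y * S) = (S' * Y * S) * Z →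
        (S * Z * S') * Y = Y * (S * Z * S') := by
      intro Y hY
      calc (S * Z * S') * Y = S * (Z * (S' * Y * S)) * S' := by
            simp only [Matrix.mul_assoc, h1, Matrix.mul_one]
        _ = (S * S') * Y * (S * Z * S') := by rw [hY]; simp only [Matrix.mul_assoc]
        _ = _ := by rw [h1, Matrix.one_mul]
    obtain ⟨c, hc⟩ := h5 (S * Z * S') (key B hZB) (key A₂ (by rw [← hA]; exact hZA))
    refine ⟨c, ?_⟩
    calc Z = (S' * S) * Z * (S' * S) := by rw [h2, Matrix.one_mul, Matrix.mul_one]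
      _ = S' * (S * Z * S') * S := by simp only [Matrix.mul_assoc]
      _ = _ := by rw [hc]; simp [h2]

theorem P2_finish {m : ℕ} {A B : Matrix (Fin (m+2)) (Fin (m+2)) ℂ} {P Q cA cB : ℂ} {p p' q q' : Fin m → ℂ}
    {A' B' B'' : Matrix (Fin m) (Fin m) ℂ} (hA : Sim A (M3 P p 1 p' A' 0 cA 0 0))
    (hB : Sim B (M3 Q q 1 q' B' 0 cB 0 0)) (h : Sim B'' B') (hA' : IsUnit A') (hcA : cA ≠ 0)
    {s : Finset ℂ} (h0 : (0 : ℂ) ∉ s) {a b : ℂ} (ha : a ∈ s) (hb : b ∈ s) (hab : a ≠ b) (hc : cA * cB = a * b)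
    (hch : (A' * B'').charpoly = ∏ z ∈ (s.erase a).erase b, (X - C z))
    (hcent : ∀ (W : Matrix (Fin m) (Fin m) ℂ) (z : ℂ), W * A' = A' * W → W * B'' = B'' * W → W *ᵥ p' = z • p' →
          W = z • (1 : Matrix _ _ ℂ)) : Goal2 A B s := by
  have ha0 : a ≠ 0 := fun h => h0 (h ▸ ha)
  obtain ⟨B₂, hB₂, ⟨u, v, w, hN⟩, hPT⟩ := combine (κ := a) hA hB h ha0
  have hb' : cA * (cB / a) = b := by rw [← mul_div_assoc, hc]; field_simp
  rw [hb'] at hN hPT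
  have hz : ∀ z, z ∉ (s.erase a).erase b → gm (A' * B'') z = 0 := by
    intro z hz
    by_contra h1
    have := (charpoly_eval_iff (A' * B'') z).2 (Nat.pos_of_ne_zero h1)
    rw [hch, Polynomial.eval_prod, Finset.prod_eq_zero_iff] at this
    obtain ⟨y, hy, hy'⟩ := this
    rw [eval_sub, eval_X, eval_C, sub_eq_zero] at hy'
    exact hz (hy' ▸ hy)
  refine ⟨B₂, hB₂, ?_, hPT hA' hcA hab (hz a (by simp)) (hz b (by simp)) hcent⟩
  rw [hN.charpoly, M3_upper_charpoly, hch, Finset.prod_erase_mul _ _ (Finset.mem_erase.2 ⟨hab.symm, hb⟩),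
    Finset.mul_prod_erase s (fun z => X - C z) ha]

theorem layer_rank_one {m : ℕ} {Q c ν : ℂ} {q q' : Fin m → ℂ} {B' : Matrix (Fin m) (Fin m) ℂ}
    (h : m + 1 ≤ gm (M3 Q q 1 q' B' 0 c 0 0) ν) : B' = ν • (1 : Matrix _ _ ℂ) := by
  set N := M3 Q q 1 q' B' 0 c 0 0 - ν • (1 : Matrix _ _ ℂ) with hN
  have hr : N.rank ≤ 1 := by
    have := gm_add_rank (M3 Q q 1 q' B' 0 c 0 0) ν
    simp only [Fintype.card_sum, Fintype.card_unit, Fintype.card_fin, I3] at this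
    rw [← hN] at this
    omega
  rw [Matrix.rank, finrank_le_one_iff] at hr
  obtain ⟨⟨w, hw⟩, hw2⟩ := hr
  have hcol : ∀ j, ∃ a : ℂ, ∀ i, N i j = a * w i := by
    intro j
    obtain ⟨a, ha⟩ := hw2 ⟨N *ᵥ Pi.single j 1, ⟨Pi.single j 1, rfl⟩⟩
    refine ⟨a, fun i => ?_⟩
    have ha' : a • w = N *ᵥ Pi.single j 1 := congrArg Subtype.val ha
    have := congrFun ha' i
    rw [Matrix.mulVec_single_one] at this
    simpa using this.symm
  have hN' : N = M3 (Q - ν) q 1 q' (B' - ν • (1 : Matrix _ _ ℂ)) 0 c 0 (0 - ν) := by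
    rw [hN, M3_one, M3_smul]
    ext (i | i | i) (j | j | j) <;> simp [M3]
  rw [hN'] at hcol
  obtain ⟨a3, h3⟩ := hcol (.inr (.inr ()))
  rw [← sub_eq_zero]
  ext i j
  obtain ⟨aj, hj⟩ := hcol (.inr (.inl j))
  have e1 := h3 (.inl ())
  have e2 := h3 (.inr (.inl i))
  have e3 := hj (.inr (.inl i))
  simp only [M3] at e1 e2 e3
  simp at e1 e2 e3
  have ha3 : a3 ≠ 0 := by rintro rfl; simp at e1
  rw [e2.resolve_left ha3, mul_zero] at e3
  simpa using e3

theorem quad_det {m : ℕ} {A : Matrix (Fin m) (Fin m) ℂ} {β : ℂ}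
    (h : (A - β • (1 : Matrix _ _ ℂ)) * (A - β • (1 : Matrix _ _ ℂ)) = 0) : A.det = β ^ m := by
  have hr : A.charpoly.roots = Multiset.replicate m β := by
    rw [Multiset.eq_replicate]
    constructor
    · rw [IsAlgClosed.card_roots_eq_natDegree, Matrix.charpoly_natDegree_eq_dim, Fintype.card_fin]
    · intro μ hμ
      rw [Polynomial.mem_roots A.charpoly_monic.ne_zero] at hμ
      have := quad_ev h ((charpoly_eval_iff A μ).1 hμ)
      tauto
  rw [Matrix.det_eq_prod_roots_charpoly, hr, Multiset.prod_replicate]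

theorem quad_exc {m : ℕ} (hm : 3 ≤ m) {A : Matrix (Fin (m+2)) (Fin (m+2)) ℂ} {A' : Matrix (Fin m) (Fin m) ℂ}
    (hq : ¬ Quad A) (hg : ∀ μ, gm A' μ ≤ 1 ∨ gm A' μ + 1 ≤ gm A μ) (hq' : Quad A') (h2 : ∀ μ, 2 * gm A' μ ≤ m) :
    ∃ β, m + 2 ≤ 2 * gm A β ∧ A'.det = β ^ m := by
  obtain ⟨β, γ, hbg⟩ := hq'
  have h1 := quad_sum hbg
  rw [Fintype.card_fin] at h1
  have := h2 β
  have := h2 γ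
  have := hg β
  have := hg γ
  by_cases hne : β = γ
  · subst hne
    exact ⟨β, by omega, quad_det hbg⟩
  · exact absurd ⟨β, γ, quad_of_sum hne (by rw [Fintype.card_fin]; omega)⟩ hq

theorem charpoly_one (A : Matrix (Fin 1) (Fin 1) ℂ) : A.charpoly = X - C A.det := by
  simp [Matrix.charpoly, Matrix.charmatrix]

theorem P2_small {n : ℕ} (hn : n ≤ 1) (A B : Matrix (Fin n) (Fin n) ℂ) (s : Finset ℂ) (hs : s.card = n)
    (hp : ∏ z ∈ s, z = A.det * B.det) : Goal2 A B s := by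
  refine ⟨B, Sim.refl B, ?_, fun Z _ _ => scal_small hn Z⟩
  obtain rfl | rfl : n = 0 ∨ n = 1 := by omega
  · rw [Finset.card_eq_zero] at hs; subst hs; simp [Matrix.charpoly]
  · obtain ⟨z, rfl⟩ := Finset.card_eq_one.1 hs
    rw [Finset.prod_singleton] at hp ⊢
    rw [charpoly_one, Matrix.det_mul, hp]

theorem P2_step {m : ℕ} (hm : 1 ≤ m)
    (ih : ∀ (A B : Matrix (Fin m) (Fin m) ℂ), IsUnit A → IsUnit B →
      (2 ≤ m → (∀ μ ν, gm A μ + gm B ν ≤ m) ∧ (m = 2 ∨ ¬ Quad A ∨ ¬ Quad B)) → ∀ s : Finset ℂ, s.card = m →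
      0 ∉ s → ∏ z ∈ s, z = A.det * B.det → Goal2 A B s)
    (A B : Matrix (Fin (m+2)) (Fin (m+2)) ℂ) (hA : IsUnit A) (hB : IsUnit B)
    (hg : ∀ μ ν, gm A μ + gm B ν ≤ m + 2) (hq : ¬ Quad A) (s : Finset ℂ) (hs : s.card = m + 2)
    (h0 : (0 : ℂ) ∉ s) (hp : ∏ z ∈ s, z = A.det * B.det) : Goal2 A B s := by
  obtain ⟨μA, hμA⟩ := exists_gm_pos A
  obtain ⟨μB, hμB⟩ := exists_gm_pos B
  have hsB : ¬ Scal B := by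
    rintro ⟨β, hβ⟩
    have := hg μA β
    rw [hβ, gm_scal, if_pos rfl, Fintype.card_fin] at this
    omega
  have hsA : ¬ Scal A := fun h => hq h.quad
  obtain ⟨cB, Q, q, q', B', hcB, hSB, hB', hgB⟩ := layer_gen B hB hsB
  have hne0 : ∀ z ∈ s, z ≠ 0 := fun z hz h => h0 (h ▸ hz)
  have hprod : ∀ a ∈ s, ∀ b ∈ s, a ≠ b → a * b * ∏ z ∈ (s.erase a).erase b, z = A.det * B.det := by
    intro a ha b hb hab
    rw [← hp, ← Finset.mul_prod_erase s (fun z => z) ha,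
      ← Finset.mul_prod_erase (s.erase a) (fun z => z) (Finset.mem_erase.2 ⟨hab.symm, hb⟩)]
    ring
  have hcard : ∀ a ∈ s, ∀ b ∈ s, a ≠ b → ((s.erase a).erase b).card = m := by
    intro a ha b hb hab
    have h1 := Finset.card_erase_add_one ha
    have h2 := Finset.card_erase_add_one (Finset.mem_erase.2 ⟨hab.symm, hb⟩)
    omega
  obtain ⟨a, ha⟩ : s.Nonempty := by rw [← Finset.card_pos]; omega
  have ha1 := Finset.card_erase_add_one ha
  by_cases hlev : 2 ≤ m ∧ ∃ ν, m + 1 ≤ gm B ν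
  · obtain ⟨hm2, ν, hν⟩ := hlev
    obtain ⟨b, hb⟩ : (s.erase a).Nonempty := by rw [← Finset.card_pos]; omega
    have hab : a ≠ b := (Finset.mem_erase.1 hb).1.symm
    have hbs := (Finset.mem_erase.1 hb).2
    have hB'e : B' = ν • (1 : Matrix _ _ ℂ) := layer_rank_one (by rw [← hSB.gm_eq]; exact hν)
    have hν0 : ν ≠ 0 := scal_ne_zero (n := m) (by omega) (by rw [← hB'e]; exact hB')
    let eq := (s.erase a |>.erase b).equivFinOfCardEq (hcard a ha b hbs hab)
    let t : Fin m → ℂ := fun i => (eq.symm i).1 / ν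
    have htinj : Function.Injective t := by
      intro i j hij
      have : (eq.symm i).1 = (eq.symm j).1 := by
        have := congrArg (· * ν) hij
        simpa [t, hν0] using this
      exact eq.symm.injective (Subtype.ext this)
    have ht0 : ∀ i, t i ≠ 0 := fun i => div_ne_zero
      (hne0 _ (Finset.mem_of_mem_erase (Finset.mem_of_mem_erase (eq.symm i).2))) hν0
    obtain ⟨cA, P, p, p', hcA, hSA, hp'⟩ := levelt A hA (fun μ => by have := hg μ ν; omega) t htinj ht0
    have hAB : diagonal t * B' = diagonal fun i => (eq.symm i).1 := by
      rw [hB'e, Matrix.mul_smul, Matrix.mul_one, ← Matrix.diagonal_smul]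
      congr 1; ext i
      simp only [t, Pi.smul_apply, smul_eq_mul]; field_simp
    have hpr : ∀ {M : Type} [CommMonoid M] (f : ℂ → M), ∏ i, f (eq.symm i).1 = ∏ z ∈ (s.erase a).erase b, f z := by
      intro M _ f
      rw [← Finset.prod_coe_sort ((s.erase a).erase b) f]
      exact Fintype.prod_equiv eq.symm _ _ (fun i => rfl)
    have hc : cA * cB = a * b := by
      have h1 := det_layers hSA hSB
      rw [← Matrix.det_mul (diagonal t) B', hAB, Matrix.det_diagonal, hpr (fun z => z), ← hprod a ha b hbs hab] at h1
      refine (mul_right_cancel₀ ?_ h1).symm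
      exact Finset.prod_ne_zero_iff.2 fun z hz => hne0 z (Finset.mem_of_mem_erase (Finset.mem_of_mem_erase hz))
    refine P2_finish hSA hSB (Sim.refl B') ?_ hcA h0 ha hbs hab hc ?_ ?_
    · rw [Matrix.isUnit_iff_isUnit_det, Matrix.det_diagonal, isUnit_iff_ne_zero]
      exact Finset.prod_ne_zero_iff.2 fun i _ => ht0 i
    · rw [hAB, Matrix.charpoly_diagonal, hpr (fun z => X - C z)]
    · intro W z hW _ hWp
      have hdiag : ∀ i j, i ≠ j → W i j = 0 := by
        intro i j hij
        have := congrFun (congrFun hW i) j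
        rw [Matrix.mul_diagonal, Matrix.diagonal_mul] at this
        have h2 : W i j * (t j - t i) = 0 := by rw [mul_sub, this]; ring
        exact (mul_eq_zero.1 h2).resolve_right (sub_ne_zero.2 fun h => hij (htinj h.symm))
      ext i j
      by_cases hij : i = j
      · subst hij
        have := congrFun hWp i
        rw [Matrix.mulVec, dotProduct, Finset.sum_eq_single i (fun j _ hj => by rw [hdiag i j hj.symm, zero_mul]) (by simp)] at this
        simpa using mul_right_cancel₀ (hp' i) this
      · rw [hdiag i j hij]; simp [hij]
  · have hbd : 2 ≤ m → ∀ A' : Matrix (Fin m) (Fin m) ℂ, (∀ μ, gm A' μ ≤ 1 ∨ gm A' μ + 1 ≤ gm A μ) →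
        ∀ μ ν, gm A' μ + gm B' ν ≤ m := by
      intro hm2 A' hgA μ ν
      have h1 : gm A μ ≤ m := by
        by_contra h
        exact hq (quad_of_gm (μ := μ) (by rw [Fintype.card_fin]; omega))
      have h2 : gm B ν ≤ m := by
        by_contra h
        exact hlev ⟨hm2, ν, by omega⟩
      have := hgA μ
      have := hgB ν
      have := hg μ ν
      omega
    have hex : ∃ b ∈ s.erase a, ∃ (P : ℂ) (p p' : Fin m → ℂ) (A' : Matrix (Fin m) (Fin m) ℂ),
        Sim A (M3 P p 1 p' A' 0 (a * b / cB) 0 0) ∧ IsUnit A' ∧ (∀ μ, gm A' μ ≤ 1 ∨ gm A' μ + 1 ≤ gm A μ) ∧ p' ≠ 0 ∧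
        (m ≤ 2 ∨ ¬ Quad A' ∨ ¬ Quad B') := by
      obtain ⟨b1, hb1, b2, hb2, hb12⟩ := Finset.one_lt_card.1 (show 1 < (s.erase a).card by omega)
      have hnz : ∀ b ∈ s.erase a, a * b / cB ≠ 0 := fun b hb =>
        div_ne_zero (mul_ne_zero (hne0 a ha) (hne0 b (Finset.mem_of_mem_erase hb))) hcB
      obtain ⟨P1, p1, p1', A1, hS1, hA1, hg1, hp1⟩ := layer_pre A hA hq (a * b1 / cB) (hnz b1 hb1)
      obtain ⟨P2, p2, p2', A2, hS2, hA2, hg2, hp2⟩ := layer_pre A hA hq (a * b2 / cB) (hnz b2 hb2)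
      by_contra hcon
      have hq1 : ¬ (m ≤ 2 ∨ ¬ Quad A1 ∨ ¬ Quad B') := fun h =>
        hcon ⟨b1, hb1, P1, p1, p1', A1, hS1, hA1, hg1, hp1, h⟩
      have hq2 : ¬ (m ≤ 2 ∨ ¬ Quad A2 ∨ ¬ Quad B') := fun h =>
        hcon ⟨b2, hb2, P2, p2, p2', A2, hS2, hA2, hg2, hp2, h⟩
      simp only [not_or, not_not, not_le] at hq1 hq2
      obtain ⟨β, γ, hβγ⟩ := hq1.2.2
      have hsum := quad_sum hβγ
      rw [Fintype.card_fin] at hsum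
      obtain ⟨ν, hν⟩ : ∃ ν, m ≤ 2 * gm B' ν := by
        rcases le_total (gm B' β) (gm B' γ) with h | h
        · exact ⟨γ, by omega⟩
        · exact ⟨β, by omega⟩
      obtain ⟨β1, hβ1, hd1⟩ := quad_exc (by omega) hq hg1 hq1.2.1
        (fun μ => by have := hbd (by omega) A1 hg1 μ ν; omega)
      obtain ⟨β2, hβ2, hd2⟩ := quad_exc (by omega) hq hg2 hq2.2.1
        (fun μ => by have := hbd (by omega) A2 hg2 μ ν; omega)
      have hβ : β1 = β2 := by
        by_contra hne
        exact hq ⟨β1, β2, quad_of_sum hne (by rw [Fintype.card_fin]; omega)⟩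
      have e1 := det_layers hS1 hSB
      have e2 := det_layers hS2 hSB
      rw [e1, hd1, hd2, hβ] at e2
      have hβ0 : β2 ^ m ≠ 0 := by
        rw [← hd2]
        exact ((Matrix.isUnit_iff_isUnit_det _).1 hA2).ne_zero
      have hB0 : B'.det ≠ 0 := ((Matrix.isUnit_iff_isUnit_det _).1 hB').ne_zero
      have e3 := mul_right_cancel₀ (mul_ne_zero hβ0 hB0) e2
      rw [div_mul_cancel₀ _ hcB, div_mul_cancel₀ _ hcB] at e3
      exact hb12 (mul_left_cancel₀ (hne0 a ha) e3)
    obtain ⟨b, hb, P, p, p', A', hSA, hA', hgA, hp', hqq⟩ := hex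
    have hab : a ≠ b := (Finset.mem_erase.1 hb).1.symm
    have hbs := (Finset.mem_erase.1 hb).2
    have hc : a * b / cB * cB = a * b := by field_simp
    have hdet := det_layers hSA hSB
    rw [hc, ← hprod a ha b hbs hab] at hdet
    have hab0 : a * b ≠ 0 := mul_ne_zero (hne0 a ha) (hne0 b hbs)
    obtain ⟨B'', hB'', hch, hPT⟩ := ih A' B' hA' hB' (by
      intro hm2
      exact ⟨hbd hm2 A' hgA, hqq.imp (fun h => by omega) id⟩) ((s.erase a).erase b) (hcard a ha b hbs hab)
      (fun h => h0 (Finset.mem_of_mem_erase (Finset.mem_of_mem_erase h))) (mul_left_cancel₀ hab0 hdet)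
    refine P2_finish hSA hSB hB'' hA' (div_ne_zero hab0 hcB) h0 ha hbs hab hc hch ?_
    intro W z h1 h2 h3
    obtain ⟨c, rfl⟩ := hPT W h1 h2
    obtain ⟨i, hi⟩ := Function.ne_iff.1 hp'
    have := congrFun h3 i
    rw [Matrix.smul_mulVec, Matrix.one_mulVec] at this
    rw [mul_right_cancel₀ hi this]

theorem P2_two (A B : Matrix (Fin 2) (Fin 2) ℂ) (hA : IsUnit A) (hB : IsUnit B)
    (hg : ∀ μ ν, gm A μ + gm B ν ≤ 2) (s : Finset ℂ) (hs : s.card = 2)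
    (h0 : (0 : ℂ) ∉ s) (hp : ∏ z ∈ s, z = A.det * B.det) : Goal2 A B s := by
  obtain ⟨μA, hμA⟩ := exists_gm_pos A
  obtain ⟨μB, hμB⟩ := exists_gm_pos B
  have hsB : ¬ Scal B := by
    rintro ⟨β, hβ⟩
    have := hg μA β
    rw [hβ, gm_scal, if_pos rfl, Fintype.card_fin] at this
    omega
  have hsA : ¬ Scal A := by
    rintro ⟨β, hβ⟩
    have := hg β μB
    rw [hβ, gm_scal, if_pos rfl, Fintype.card_fin] at this
    omega
  obtain ⟨cA, P, p, p', A', hcA, hSA, hA', -⟩ := layer_gen (m := 0) A hA hsA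
  obtain ⟨cB, Q, q, q', B', hcB, hSB, hB', -⟩ := layer_gen (m := 0) B hB hsB
  obtain ⟨a, b, hab, rfl⟩ := Finset.card_eq_two.1 hs
  have hd := det_layers hSA hSB
  rw [← hp, Finset.prod_pair hab] at hd
  refine P2_finish (m := 0) (a := a) (b := b) hSA hSB (Sim.refl B') hA' hcA h0 (by simp) (by simp) hab ?_ ?_ ?_
  · rw [hd]; simp
  · have : (({a, b} : Finset ℂ).erase a).erase b = ∅ := by
      ext z; simp; tauto
    rw [this]; simp [Matrix.charpoly]
  · intro W z _ _ _
    exact Subsingleton.elim _ _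

theorem P2_main : ∀ (n : ℕ) (A B : Matrix (Fin n) (Fin n) ℂ), IsUnit A → IsUnit B →
      (2 ≤ n → (∀ μ ν, gm A μ + gm B ν ≤ n) ∧ (n = 2 ∨ ¬ Quad A ∨ ¬ Quad B)) → ∀ s : Finset ℂ, s.card = n →
      0 ∉ s → ∏ z ∈ s, z = A.det * B.det → Goal2 A B s := by
  intro n
  induction n using Nat.strong_induction_on with
  | _ n ih =>
  intro A B hA hB h s hs h0 hp
  by_cases hn : n ≤ 1
  · exact P2_small hn A B s hs hp
  obtain ⟨m, rfl⟩ : ∃ m, n = m + 2 := ⟨n - 2, by omega⟩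
  obtain ⟨hg, hq⟩ := h (by omega)
  rcases Nat.eq_zero_or_pos m with rfl | hm
  · exact P2_two A B hA hB hg s hs h0 hp
  rcases hq with hq | hq | hq
  · omega
  · exact P2_step hm (ih m (by omega)) A B hA hB hg hq s hs h0 hp
  · exact (P2_step hm (ih m (by omega)) B A hB hA (fun μ ν => by rw [add_comm]; exact hg ν μ) hq s hs h0
      (by rw [hp, mul_comm])).swap

theorem ofFn_conj {n : ℕ} {S S' : Matrix (Fin n) (Fin n) ℂ} (h1 : S * S' = 1) (h2 : S' * S = 1) :
    ∀ (k : ℕ) (M : Fin k → Matrix (Fin n) (Fin n) ℂ),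
      (List.ofFn fun i => S * M i * S').prod = S * (List.ofFn M).prod * S' := by
  intro k
  induction k with
  | zero => intro M; simp [h1]
  | succ k ih =>
    intro M
    rw [List.ofFn_succ, List.prod_cons, ih (fun i => M i.succ), List.ofFn_succ, List.prod_cons]
    calc _ = S * M 0 * (S' * S) * (List.ofFn fun i => M i.succ).prod * S' := by simp only [Matrix.mul_assoc]
      _ = _ := by rw [h2, Matrix.mul_one]; simp only [Matrix.mul_assoc]

theorem ofFn_comm {n : ℕ} {Z : Matrix (Fin n) (Fin n) ℂ} :
    ∀ (k : ℕ) (M : Fin k → Matrix (Fin n) (Fin n) ℂ), (∀ i, Z * M i = M i * Z) →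
      Z * (List.ofFn M).prod = (List.ofFn M).prod * Z := by
  intro k
  induction k with
  | zero => intro M _; simp
  | succ k ih =>
    intro M h
    rw [List.ofFn_succ, List.prod_cons, ← Matrix.mul_assoc, h 0, Matrix.mul_assoc, ih (fun i => M i.succ) (fun i => h _),
      Matrix.mul_assoc]

theorem ofFn_unit {n : ℕ} : ∀ (k : ℕ) (M : Fin k → Matrix (Fin n) (Fin n) ℂ), (∀ i, IsUnit (M i)) →
    IsUnit (List.ofFn M).prod := by
  intro k
  induction k with
  | zero => intro M _; simp
  | succ k ih =>
    intro M h
    rw [List.ofFn_succ, List.prod_cons]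
    exact (h 0).mul (ih _ fun i => h _)

theorem ofFn_det {n : ℕ} : ∀ (k : ℕ) (M : Fin k → Matrix (Fin n) (Fin n) ℂ),
    (List.ofFn M).prod.det = ∏ i, (M i).det := by
  intro k
  induction k with
  | zero => intro M; simp
  | succ k ih =>
    intro M
    rw [List.ofFn_succ, List.prod_cons, Matrix.det_mul, ih, Fin.prod_univ_succ]

theorem scal_smul {n : ℕ} {β : ℂ} (hβ : β ≠ 0) {B : Matrix (Fin n) (Fin n) ℂ} (h : Scal (β • B)) : Scal B := by
  obtain ⟨γ, h⟩ := h
  exact ⟨β⁻¹ * γ, by rw [mul_smul, ← h, smul_smul, inv_mul_cancel₀ hβ, one_smul]⟩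

theorem quad_smul {n : ℕ} {β : ℂ} (hβ : β ≠ 0) {B : Matrix (Fin n) (Fin n) ℂ} (h : Quad (β • B)) : Quad B := by
  obtain ⟨γ, δ, h⟩ := h
  refine ⟨β⁻¹ * γ, β⁻¹ * δ, ?_⟩
  have e : ∀ γ : ℂ, B - (β⁻¹ * γ) • (1 : Matrix (Fin n) (Fin n) ℂ) = β⁻¹ • (β • B - γ • (1 : Matrix (Fin n) (Fin n) ℂ)) := by
    intro γ
    rw [smul_sub, smul_smul, smul_smul, inv_mul_cancel₀ hβ, one_smul]
  rw [e, e, Matrix.smul_mul, Matrix.mul_smul, h, smul_zero, smul_zero]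

theorem merge_list {n : ℕ} (hn : 2 ≤ n) : ∀ (k : ℕ) (K : Fin k → Matrix (Fin n) (Fin n) ℂ) (r : Fin k → ℕ),
    (∀ i, IsUnit (K i)) → (∀ i μ, gm (K i) μ + r i ≤ n) →
    ∃ M : Fin k → Matrix (Fin n) (Fin n) ℂ, (∀ i, Sim (M i) (K i)) ∧
      (∀ μ, gm (List.ofFn M).prod μ ≤ 1 ∨ gm (List.ofFn M).prod μ + ∑ i, r i ≤ n) ∧
      (3 ≤ n → (Quad (List.ofFn M).prod → (∀ i, Quad (K i)) ∧ ∀ i j, i ≠ j → Scal (K i) ∨ Scal (K j)) ∧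
        (Scal (List.ofFn M).prod → ∀ i, Scal (K i))) := by
  intro k
  induction k with
  | zero =>
    intro K r _ _
    refine ⟨K, fun i => i.elim0, ?_, fun _ => ⟨fun _ => ⟨fun i => i.elim0, fun i => i.elim0⟩, fun _ i => i.elim0⟩⟩
    intro μ; right
    have := gm_le_card (List.ofFn K).prod μ
    rw [Fintype.card_fin] at this
    simpa using this
  | succ k ih =>
    intro K r hK hr
    obtain ⟨M', hM', hg', hq'⟩ := ih (fun i => K i.succ) (fun i => r i.succ) (fun i => hK _) (fun i => hr _)
    have hMu : ∀ i, IsUnit (M' i) := fun i => (hM' i).isUnit (hK i.succ)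
    set D := (List.ofFn M').prod with hD
    have hDu : IsUnit D := ofFn_unit _ _ hMu
    obtain ⟨D₂, hD₂, hg, hq⟩ := merge n (K 0) D (hK 0) hDu (n - r 0) (max 1 (n - ∑ i : Fin k, r i.succ))
      (fun μ => by have := hr 0 μ; omega) (fun μ => by have := hg' μ; omega)
    have hD₂' := hD₂
    obtain ⟨S, S', h1, h2, h3⟩ := hD₂
    have hprod : (List.ofFn (Fin.cons (K 0) fun i => S * M' i * S' : Fin (k+1) → Matrix (Fin n) (Fin n) ℂ)).prod = K 0 * D₂ := by
      rw [List.ofFn_succ, List.prod_cons]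
      simp only [Fin.cons_zero, Fin.cons_succ]
      rw [ofFn_conj h1 h2, ← hD, h3]
    refine ⟨Fin.cons (K 0) fun i => S * M' i * S', ?_, ?_, ?_⟩
    · intro i
      refine Fin.cases ?_ (fun i => ?_) i
      · exact Sim.refl _
      · rw [Fin.cons_succ]; exact Sim.trans ⟨S, S', h1, h2, rfl⟩ (hM' i)
    · rw [hprod, Fin.sum_univ_succ]
      intro μ
      have := hg μ
      have := hr 0 μ
      omega
    · rw [hprod]
      intro hn3
      obtain ⟨hq1, hq2⟩ := hq' hn3
      have hcase : Quad (K 0 * D₂) → Scal (K 0) ∨ Scal D := by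
        intro h
        by_contra hc
        rw [not_or] at hc
        exact hq hn3 hc.1 hc.2 h
      have hrest : Scal D → ∃ γ : ℂ, γ ≠ 0 ∧ K 0 * D₂ = γ • K 0 := by
        intro h
        obtain ⟨γ, hγ⟩ := hD₂'.scal h
        refine ⟨γ, ?_, by rw [hγ]; simp⟩
        exact scal_ne_zero (n := n) (by omega) (hγ ▸ hD₂'.isUnit hDu)
      have hfst : Scal (K 0) → ∃ γ : ℂ, γ ≠ 0 ∧ K 0 * D₂ = γ • D₂ := by
        rintro ⟨γ, hγ⟩
        refine ⟨γ, ?_, by rw [hγ]; simp⟩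
        exact scal_ne_zero (n := n) (by omega) (hγ ▸ hK 0)
      refine ⟨fun h => ?_, fun h => ?_⟩
      · rcases hcase h with h0 | h0
        · obtain ⟨γ, hγ, he⟩ := hfst h0
          rw [he] at h
          obtain ⟨h4, h5⟩ := hq1 (hD₂'.symm.quad (quad_smul hγ h))
          refine ⟨fun i => Fin.cases h0.quad h4 i, ?_⟩
          intro i j
          refine Fin.cases (fun _ => Or.inl h0) (fun i => ?_) i
          refine Fin.cases (fun _ => Or.inr h0) (fun j => ?_) j
          intro hij
          exact h5 i j (fun h => hij (congrArg Fin.succ h))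
        · obtain ⟨γ, hγ, he⟩ := hrest h0
          rw [he] at h
          have h6 := hq2 h0
          refine ⟨fun i => Fin.cases (quad_smul hγ h) (fun i => (h6 i).quad) i, ?_⟩
          intro i j
          refine Fin.cases ?_ (fun i _ => Or.inl (h6 i)) i
          refine Fin.cases (fun h => absurd rfl h) (fun j _ => Or.inr (h6 j)) j
      · have hb : Scal (K 0) ∧ Scal D := by
          rcases hcase h.quad with h0 | h0
          · obtain ⟨γ, hγ, he⟩ := hfst h0
            rw [he] at h
            exact ⟨h0, hD₂'.symm.scal (scal_smul hγ h)⟩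
          · obtain ⟨γ, hγ, he⟩ := hrest h0
            rw [he] at h
            exact ⟨scal_smul hγ h, h0⟩
        exact fun i => Fin.cases hb.1 (hq2 hb.2) i

theorem charpoly_rescale {n : ℕ} {N : Matrix (Fin n) (Fin n) ℂ} {γ : ℂ} (hγ : γ ≠ 0) {s : Finset ℂ} (hs : s.card = n)
    (h : N.charpoly = ∏ z ∈ s, (X - C (z / γ))) : (γ • N).charpoly = ∏ z ∈ s, (X - C z) := by
  apply Polynomial.funext
  intro μ
  have h1 := congrArg (Polynomial.eval (μ / γ)) h
  rw [Matrix.eval_charpoly] at h1 ⊢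
  have e : Matrix.scalar (Fin n) μ - γ • N = γ • (Matrix.scalar (Fin n) (μ / γ) - N) := by
    rw [smul_sub, Matrix.scalar_apply, Matrix.scalar_apply, ← Matrix.smul_one_eq_diagonal, ← Matrix.smul_one_eq_diagonal,
      smul_smul, mul_div_cancel₀ _ hγ]
  rw [e, Matrix.det_smul, h1, Fintype.card_fin, ← hs, ← Finset.prod_const, eval_prod, eval_prod, ← Finset.prod_mul_distrib]
  refine Finset.prod_congr rfl fun z _ => ?_
  simp only [eval_sub, eval_X, eval_C]
  field_simp

def Exc {n k : ℕ} (K : Fin k → Matrix (Fin n) (Fin n) ℂ) : Prop :=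
  (∀ i, Quad (K i)) ∧ ∃ i j, ∀ l, l ≠ i → l ≠ j → Scal (K l)

theorem full {n : ℕ} (hn : 2 ≤ n) : ∀ (k : ℕ) (K : Fin k → Matrix (Fin n) (Fin n) ℂ) (r : Fin k → ℕ),
    (∀ i, IsUnit (K i)) → (∀ i μ, gm (K i) μ + r i ≤ n) → n ≤ ∑ i, r i → (3 ≤ n → ¬ Exc K) →
    ∀ s : Finset ℂ, s.card = n → 0 ∉ s → ∏ z ∈ s, z = ∏ i, (K i).det →
    ∃ M : Fin k → Matrix (Fin n) (Fin n) ℂ, (∀ i, Sim (M i) (K i)) ∧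
      (List.ofFn M).prod.charpoly = ∏ z ∈ s, (X - C z) ∧ TrivialCentralizer M := by
  intro k
  induction k with
  | zero => intro K r _ _ h; simp at h; omega
  | succ k ih =>
    intro K r hK hr hsum hexc s hs h0 hp
    rw [Fin.sum_univ_succ] at hsum
    rw [Fin.prod_univ_succ] at hp
    by_cases hsc : Scal (K 0)
    · obtain ⟨γ, hγ⟩ := id hsc
      have hγ0 : γ ≠ 0 := scal_ne_zero (n := n) (by omega) (hγ ▸ hK 0)
      have hr0 : r 0 = 0 := by
        have := hr 0 γ
        rw [hγ, gm_scal, if_pos rfl, Fintype.card_fin] at this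
        omega
      have hinj : Function.Injective fun z : ℂ => z / γ := fun a b h => by
        have := congrArg (· * γ) h
        simpa [hγ0] using this
      have himg : ∀ {N : Type} [CommMonoid N] (f : ℂ → N), ∏ z ∈ s.image (fun z => z / γ), f z = ∏ z ∈ s, f (z / γ) := by
        intro N _ f
        exact Finset.prod_image (fun a _ b _ h => hinj h)
      obtain ⟨M, hM, hch, hT⟩ := ih (fun i => K i.succ) (fun i => r i.succ) (fun i => hK _) (fun i => hr _) (by omega) (by
          rintro hn3 ⟨h1, i, j, h2⟩
          refine hexc hn3 ⟨fun i => Fin.cases hsc.quad h1 i, i.succ, j.succ, fun l => ?_⟩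
          refine Fin.cases (fun _ _ => hsc) (fun l h3 h4 => h2 l (fun h => h3 (congrArg _ h)) (fun h => h4 (congrArg _ h))) l)
        (s.image fun z => z / γ) (by rw [Finset.card_image_of_injective _ hinj, hs]) (by
          intro h
          obtain ⟨z, hz, hz'⟩ := Finset.mem_image.1 h
          rw [div_eq_zero_iff] at hz'
          exact h0 (hz'.resolve_right hγ0 ▸ hz)) (by
          rw [himg (fun z => z), Finset.prod_div_distrib, hp, Finset.prod_const, hs, hγ, Matrix.det_smul, Matrix.det_one,
            Fintype.card_fin, mul_one, mul_div_cancel_left₀ _ (pow_ne_zero _ hγ0)])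
      rw [himg (fun z => X - C z)] at hch
      refine ⟨Fin.cons (K 0) M, ?_, ?_, ?_⟩
      · intro i
        exact Fin.cases (Sim.refl _) hM i
      · rw [List.ofFn_succ, List.prod_cons]
        simp only [Fin.cons_zero, Fin.cons_succ]
        rw [hγ, Matrix.smul_mul, Matrix.one_mul]
        exact charpoly_rescale hγ0 hs hch
      · intro Z hZ
        exact hT Z fun j => hZ j.succ
    · obtain ⟨M', hM', hg', hq'⟩ := merge_list hn k (fun i => K i.succ) (fun i => r i.succ) (fun i => hK _) (fun i => hr _)
      have hMu : ∀ i, IsUnit (M' i) := fun i => (hM' i).isUnit (hK i.succ)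
      set D := (List.ofFn M').prod with hD
      have hDu : IsUnit D := ofFn_unit _ _ hMu
      obtain ⟨D₂, ⟨S, S', h1, h2, h3⟩, hch, hPT⟩ := P2_main n (K 0) D (hK 0) hDu (by
          intro _
          refine ⟨fun μ ν => ?_, ?_⟩
          · have := gm_lt_of_not_scal hsc μ
            have := hr 0 μ
            have := hg' ν
            omega
          · by_contra hc
            simp only [not_or, not_not] at hc
            have hn3 : 3 ≤ n := by omega
            obtain ⟨h4, h5⟩ := (hq' hn3).1 hc.2.2
            refine hexc hn3 ⟨fun i => Fin.cases hc.2.1 h4 i, ?_⟩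
            by_cases hall : ∃ i : Fin k, ¬ Scal (K i.succ)
            · obtain ⟨i, hi⟩ := hall
              refine ⟨0, i.succ, fun l => Fin.cases (fun h => absurd rfl h) (fun l _ hl => ?_) l⟩
              exact (h5 i l (fun h => hl (congrArg _ h.symm))).resolve_left hi
            · push Not at hall
              exact ⟨0, 0, fun l => Fin.cases (fun h => absurd rfl h) (fun l _ _ => hall l) l⟩) s hs h0 (by
          rw [hp, hD, ofFn_det]
          congr 1
          exact Finset.prod_congr rfl fun i _ => (hM' i).det.symm)
      have hprod : (List.ofFn fun i => S * M' i * S').prod = D₂ := by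
        rw [ofFn_conj h1 h2, ← hD, h3]
      refine ⟨Fin.cons (K 0) fun i => S * M' i * S', ?_, ?_, ?_⟩
      · intro i
        refine Fin.cases ?_ (fun i => ?_) i
        · exact Sim.refl _
        · rw [Fin.cons_succ]; exact Sim.trans ⟨S, S', h1, h2, rfl⟩ (hM' i)
      · rw [List.ofFn_succ, List.prod_cons]
        simp only [Fin.cons_zero, Fin.cons_succ]
        rw [hprod, hch]
      · intro Z hZ
        refine hPT Z (hZ 0) ?_
        rw [← hprod]
        exact ofFn_comm _ _ fun i => hZ i.succ

theorem rk_le {n : ℕ} (Y : Matrix (Fin n) (Fin n) ℂ) (μ : ℂ) : gm Y μ + rk Y ≤ n := by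
  have h1 : rk Y ≤ (Y - μ • (1 : Matrix (Fin n) (Fin n) ℂ)).rank := ciInf_le (OrderBot.bddBelow _) μ
  have h2 := gm_add_rank Y μ
  rw [Fintype.card_fin] at h2
  omega

theorem rk_att {n : ℕ} (Y : Matrix (Fin n) (Fin n) ℂ) : ∃ μ : ℂ, (Y - μ • (1 : Matrix (Fin n) (Fin n) ℂ)).rank = rk Y :=
  Nat.sInf_mem (Set.range_nonempty fun μ : ℂ => (Y - μ • (1 : Matrix (Fin n) (Fin n) ℂ)).rank)

theorem rk_sim {n : ℕ} {Y Z : Matrix (Fin n) (Fin n) ℂ} (h : Sim Y Z) : rk Y = rk Z := by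
  unfold rk
  congr 1; ext μ
  have h1 := gm_add_rank Y μ
  have h2 := gm_add_rank Z μ
  rw [h.gm_eq] at h1
  omega

theorem dd_add {n : ℕ} (Y : Matrix (Fin n) (Fin n) ℂ) : dd Y + Module.finrank ℂ (centSub Y) = n ^ 2 := by
  have h := Submodule.finrank_le (centSub Y)
  rw [Module.finrank_matrix, Fintype.card_fin, Module.finrank_self] at h
  unfold dd
  have : n ^ 2 = n * n * 1 := by ring
  omega

theorem ker_sylv {n : ℕ} (Y : Matrix (Fin n) (Fin n) ℂ) : LinearMap.ker (sylv Y Y) = centSub Y := by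
  ext Z
  change Y * Z - Z * Y = 0 ↔ Y * Z = Z * Y
  exact sub_eq_zero

theorem dd_eq_rank {n : ℕ} (Y : Matrix (Fin n) (Fin n) ℂ) : Module.finrank ℂ (LinearMap.range (sylv Y Y)) = dd Y := by
  have h1 := LinearMap.finrank_range_add_finrank_ker (sylv Y Y)
  rw [ker_sylv, Module.finrank_matrix, Fintype.card_fin, Module.finrank_self] at h1
  have h2 := dd_add Y
  have : n ^ 2 = n * n * 1 := by ring
  omega

theorem cent_sim_le {n : ℕ} {Y Z : Matrix (Fin n) (Fin n) ℂ} (h : Sim Y Z) :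
    Module.finrank ℂ (centSub Z) ≤ Module.finrank ℂ (centSub Y) := by
  obtain ⟨S, S', h1, h2, h3⟩ := h
  let f : Matrix (Fin n) (Fin n) ℂ →ₗ[ℂ] Matrix (Fin n) (Fin n) ℂ :=
    (LinearMap.mulRight ℂ S').comp (LinearMap.mulLeft ℂ S)
  have hf : ∀ X, f X = S * X * S' := fun X => rfl
  have hm : ∀ X ∈ centSub Z, f X ∈ centSub Y := by
    intro X hX
    have hX' : Z * X = X * Z := hX
    change Y * f X = f X * Y
    rw [hf, h3]
    calc _ = S * (Z * (S' * S) * X) * S' := by simp only [Matrix.mul_assoc]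
      _ = S * (X * (S' * S) * Z) * S' := by rw [h2, Matrix.mul_one, hX', Matrix.mul_one]
      _ = _ := by simp only [Matrix.mul_assoc]
  refine LinearMap.finrank_le_finrank_of_injective (f := f.restrict hm) ?_
  intro a b hab
  have h4 : S * a.1 * S' = S * b.1 * S' := congrArg Subtype.val hab
  apply Subtype.ext
  calc a.1 = (S' * S) * a.1 * (S' * S) := by rw [h2, Matrix.one_mul, Matrix.mul_one]
    _ = S' * (S * a.1 * S') * S := by simp only [Matrix.mul_assoc]
    _ = (S' * S) * b.1 * (S' * S) := by rw [h4]; simp only [Matrix.mul_assoc]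
    _ = b.1 := by rw [h2, Matrix.one_mul, Matrix.mul_one]

theorem dd_sim {n : ℕ} {Y Z : Matrix (Fin n) (Fin n) ℂ} (h : Sim Y Z) : dd Y = dd Z := by
  unfold dd
  rw [le_antisymm (cent_sim_le h) (cent_sim_le h.symm)]

theorem dd_scal {n : ℕ} {Y : Matrix (Fin n) (Fin n) ℂ} (h : Scal Y) : dd Y = 0 := by
  obtain ⟨β, rfl⟩ := h
  rw [← dd_eq_rank]
  have : sylv (β • (1 : Matrix (Fin n) (Fin n) ℂ)) (β • (1 : Matrix (Fin n) (Fin n) ℂ)) = 0 := by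
    ext1 Z
    change (β • (1 : Matrix (Fin n) (Fin n) ℂ)) * Z - Z * (β • 1) = 0
    simp
  rw [this, LinearMap.range_zero, finrank_bot]

theorem dd_diag {n : ℕ} (μ : Fin n → ℂ) : dd (diagonal μ) + n ≤ n ^ 2 := by
  have h := dd_add (diagonal μ)
  have h2 : n ≤ Module.finrank ℂ (centSub (diagonal μ)) := by
    have hm : ∀ v, Matrix.diagonalLinearMap (Fin n) ℂ ℂ v ∈ centSub (diagonal μ) := by
      intro v
      change diagonal μ * diagonal v = diagonal v * diagonal μ
      rw [Matrix.diagonal_mul_diagonal, Matrix.diagonal_mul_diagonal]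
      congr 1; ext i; ring
    have := LinearMap.finrank_le_finrank_of_injective
      (f := LinearMap.codRestrict (centSub (diagonal μ)) (Matrix.diagonalLinearMap (Fin n) ℂ ℂ) hm) (by
        intro a b hab
        exact Matrix.diagonal_injective (congrArg Subtype.val hab))
    rwa [Module.finrank_fintype_fun_eq_card, Fintype.card_fin] at this
  omega

theorem ds_diag {n : ℕ} {A : Matrix (Fin n) (Fin n) ℂ} {μ : Fin n → ℂ} (hμ : Function.Injective μ)
    (h : A.charpoly = ∏ k, (X - C (μ k))) : Sim A (diagonal μ) := by
  have hev : ∀ k, ∃ v, v ≠ 0 ∧ A *ᵥ v = μ k • v := by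
    intro k
    rw [← gm_pos_iff, ← charpoly_eval_iff, h, eval_prod]
    exact Finset.prod_eq_zero (Finset.mem_univ k) (by simp)
  choose v hv0 hv using hev
  have hli : LinearIndependent ℂ v := by
    refine Module.End.eigenvectors_linearIndependent' A.mulVecLin μ hμ v fun k => ?_
    exact ⟨Module.End.mem_eigenspace_iff.2 (hv k), hv0 k⟩
  let S : Matrix (Fin n) (Fin n) ℂ := of fun i k => v k i
  have hS : IsUnit S := by
    rw [← Matrix.linearIndependent_cols_iff_isUnit]
    exact hli
  have hd := (Matrix.isUnit_iff_isUnit_det _).1 hS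
  refine ⟨S, S⁻¹, Matrix.mul_nonsing_inv _ hd, Matrix.nonsing_inv_mul _ hd, ?_⟩
  have : A * S = S * diagonal μ := by
    ext i k
    rw [Matrix.mul_diagonal]
    have := congrFun (hv k) i
    simp only [Pi.smul_apply, smul_eq_mul] at this
    simpa [S, Matrix.mul_apply, Matrix.mulVec, dotProduct, mul_comm] using this
  rw [← this, Matrix.mul_assoc, Matrix.mul_nonsing_inv _ hd, Matrix.mul_one]

theorem gen_rank {E E' V W : Type} [AddCommGroup E] [Module ℂ E] [FiniteDimensional ℂ E] [AddCommGroup E'] [Module ℂ E']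
    [AddCommGroup V] [Module ℂ V] [FiniteDimensional ℂ V] [AddCommGroup W] [Module ℂ W] [FiniteDimensional ℂ W]
    (k : E →ₗ[ℂ] (V →ₗ[ℂ] W)) (G : E →ₗ[ℂ] E') (h : LinearMap.ker k ≤ LinearMap.ker G) :
    Module.finrank ℂ (LinearMap.range G) ≤ Module.finrank ℂ V * Module.finrank ℂ W := by
  have h1 := Submodule.finrank_mono h
  have h2 := LinearMap.finrank_range_add_finrank_ker k
  have h3 := LinearMap.finrank_range_add_finrank_ker G
  have h4 := Submodule.finrank_le (LinearMap.range k)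
  rw [Module.finrank_linearMap] at h4
  omega

theorem sandwich_rank {n : ℕ} (K L : Matrix (Fin n) (Fin n) ℂ) :
    Module.finrank ℂ (LinearMap.range ((LinearMap.mulRight ℂ L).comp (LinearMap.mulLeft ℂ K))) ≤ K.rank * L.rank := by
  rw [mul_comm]
  refine gen_rank (V := LinearMap.range L.mulVecLin) (W := LinearMap.range K.mulVecLin)
    { toFun := fun Z => K.mulVecLin.rangeRestrict.comp (Z.mulVecLin.comp (Submodule.subtype _))
      map_add' := fun Z W => LinearMap.ext fun v => Subtype.ext (by
        change K *ᵥ ((Z + W) *ᵥ v.1) = K *ᵥ (Z *ᵥ v.1) + K *ᵥ (W *ᵥ v.1)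
        rw [Matrix.add_mulVec, Matrix.mulVec_add])
      map_smul' := fun c Z => LinearMap.ext fun v => Subtype.ext (by
        change K *ᵥ ((c • Z) *ᵥ v.1) = c • (K *ᵥ (Z *ᵥ v.1))
        rw [Matrix.smul_mulVec, Matrix.mulVec_smul]) } _ ?_
  intro Z hZ
  change K * Z * L = 0
  apply Matrix.ext_of_mulVec_single
  intro i
  have h1 := LinearMap.congr_fun (LinearMap.mem_ker.1 hZ) ⟨L *ᵥ Pi.single i 1, ⟨_, rfl⟩⟩
  have h2 : K *ᵥ (Z *ᵥ (L *ᵥ Pi.single i 1)) = 0 := congrArg Subtype.val h1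
  rw [Matrix.zero_mulVec, ← h2]
  simp only [Matrix.mulVec_mulVec, Matrix.mul_assoc]

theorem dd_quad {n : ℕ} {Y : Matrix (Fin n) (Fin n) ℂ} (h : Quad Y) : 2 * dd Y ≤ n ^ 2 := by
  obtain ⟨β, γ, h⟩ := h
  set K := Y - β • (1 : Matrix (Fin n) (Fin n) ℂ) with hK
  have hsylv : ∀ Z, sylv Y Y Z = K * Z - Z * K := by
    intro Z
    change Y * Z - Z * Y = _
    rw [hK, Matrix.sub_mul, Matrix.mul_sub]; simp
  by_cases hbg : β = γ
  · subst hbg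
    obtain ⟨f, hf⟩ := LinearMap.exists_leftInverse_of_injective (Submodule.subtype (LinearMap.ker K.mulVecLin))
      (Submodule.ker_subtype _)
    let π : Matrix (Fin n) (Fin n) ℂ := LinearMap.toMatrix' ((Submodule.subtype (LinearMap.ker K.mulVecLin)).comp f)
    have hπ : ∀ v, π *ᵥ v = (f v).1 := by
      intro v
      simp only [π]
      rw [← Matrix.toLin'_apply, Matrix.toLin'_toMatrix']; rfl
    have hπker : ∀ v, K *ᵥ v = 0 → π *ᵥ v = v := by
      intro v hv
      rw [hπ]
      exact congrArg Subtype.val (LinearMap.congr_fun hf ⟨v, hv⟩)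
    have hKπ : K * π = 0 := by
      apply Matrix.ext_of_mulVec_single
      intro i
      rw [← Matrix.mulVec_mulVec, hπ, Matrix.zero_mulVec]
      exact (f (Pi.single i 1)).2
    have hπK : π * K = K := by
      apply Matrix.ext_of_mulVec_single
      intro i
      rw [← Matrix.mulVec_mulVec]
      apply hπker
      rw [Matrix.mulVec_mulVec, h, Matrix.zero_mulVec]
    have hππ : π * π = π := by
      apply Matrix.ext_of_mulVec_single
      intro i
      rw [← Matrix.mulVec_mulVec]
      apply hπker
      rw [Matrix.mulVec_mulVec, hKπ, Matrix.zero_mulVec]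
    let T : Matrix (Fin n) (Fin n) ℂ := 1 - (2 : ℂ) • π
    have hTT : T * T = 1 := by
      simp only [T, Matrix.mul_sub, Matrix.sub_mul, Matrix.smul_mul, Matrix.mul_smul, Matrix.one_mul, Matrix.mul_one, hππ]
      module
    have hTK : T * K = - K := by
      simp only [T, Matrix.sub_mul, Matrix.smul_mul, Matrix.one_mul, hπK]
      module
    have hKT : K * T = K := by
      simp only [T, Matrix.mul_sub, Matrix.mul_smul, Matrix.mul_one, hKπ]
      simp
    have hle : Module.finrank ℂ (LinearMap.range (sylv Y Y)) ≤ Module.finrank ℂ (centSub Y) := by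
      have hm : ∀ Z ∈ LinearMap.range (sylv Y Y), LinearMap.mulRight ℂ T Z ∈ centSub Y := by
        rintro _ ⟨Z, rfl⟩
        rw [← ker_sylv, LinearMap.mem_ker, LinearMap.mulRight_apply, hsylv, hsylv]
        calc _ = (K * K) * Z * T - K * Z * (K * T) - (K * Z * (T * K) - Z * (K * (T * K))) := by
              simp only [Matrix.mul_sub, Matrix.sub_mul, Matrix.mul_assoc]
          _ = 0 := by rw [hKT, hTK, Matrix.mul_neg, Matrix.mul_neg, Matrix.mul_neg, h]; simp
      refine LinearMap.finrank_le_finrank_of_injective (f := (LinearMap.mulRight ℂ T).restrict hm) ?_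
      intro a b hab
      have h4 : a.1 * T = b.1 * T := congrArg Subtype.val hab
      apply Subtype.ext
      rw [← Matrix.mul_one a.1, ← Matrix.mul_one b.1, ← hTT, ← Matrix.mul_assoc, h4, Matrix.mul_assoc]
    have := dd_add Y
    rw [dd_eq_rank] at hle
    omega
  · set L := Y - γ • (1 : Matrix (Fin n) (Fin n) ℂ) with hL
    obtain ⟨δ, hdd⟩ : ∃ δ, δ = β - γ := ⟨_, rfl⟩
    have hδ : δ ≠ 0 := by rw [hdd]; exact sub_ne_zero.2 hbg
    have hLK : L = K + δ • (1 : Matrix (Fin n) (Fin n) ℂ) := by rw [hL, hK, hdd]; module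
    have hle : LinearMap.range (sylv Y Y) ≤
        LinearMap.range ((LinearMap.mulRight ℂ L).comp (LinearMap.mulLeft ℂ K)) ⊔
        LinearMap.range ((LinearMap.mulRight ℂ K).comp (LinearMap.mulLeft ℂ L)) := by
      rintro _ ⟨Z, rfl⟩
      have e : sylv Y Y Z = K * (δ⁻¹ • Z) * L + L * (- δ⁻¹ • Z) * K := by
        rw [hsylv, hLK]
        simp only [Matrix.mul_add, Matrix.add_mul, Matrix.mul_smul, Matrix.smul_mul, Matrix.mul_one, Matrix.one_mul,
          smul_smul, smul_add, mul_inv_cancel₀ hδ, neg_smul, neg_mul, mul_neg]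
        match_scalars <;> (try field_simp) <;> (try ring)
      rw [e]
      exact Submodule.add_mem_sup ⟨_, rfl⟩ ⟨_, rfl⟩
    have h1 := Submodule.finrank_mono hle
    have h2 := Submodule.finrank_add_le_finrank_add_finrank
      (LinearMap.range ((LinearMap.mulRight ℂ L).comp (LinearMap.mulLeft ℂ K)))
      (LinearMap.range ((LinearMap.mulRight ℂ K).comp (LinearMap.mulLeft ℂ L)))
    have h3 := sandwich_rank K L
    have h4 := sandwich_rank L K
    rw [dd_eq_rank] at h1
    have h5 := quad_sum h
    have h6 := gm_add_rank Y β
    have h7 := gm_add_rank Y γ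
    rw [Fintype.card_fin] at h5 h6 h7
    rw [← hK] at h6
    rw [← hL] at h7
    have h8 : K.rank + L.rank ≤ n := by omega
    have h9 : dd Y ≤ 2 * (K.rank * L.rank) := by
      rw [mul_comm L.rank] at h4; omega
    have h10 : (K.rank + L.rank) ^ 2 ≤ n ^ 2 := Nat.pow_le_pow_left h8 2
    zify at h9 h10 ⊢
    nlinarith [sq_nonneg ((K.rank : ℤ) - L.rank)]

theorem exc_dd {n k : ℕ} {K : Fin k → Matrix (Fin n) (Fin n) ℂ} (h : Exc K) : ∑ i, dd (K i) ≤ n ^ 2 := by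
  obtain ⟨hq, i, j, hs⟩ := h
  have h1 : ∑ l, dd (K l) = ∑ l ∈ ({i, j} : Finset (Fin k)), dd (K l) := by
    symm
    apply Finset.sum_subset (Finset.subset_univ _)
    intro l _ hl
    simp only [Finset.mem_insert, Finset.mem_singleton, not_or] at hl
    exact dd_scal (hs l hl.1 hl.2)
  have h2 := dd_quad (hq i)
  have h3 := dd_quad (hq j)
  rw [h1]
  by_cases hij : i = j
  · subst hij; simp; omega
  · rw [Finset.sum_pair hij]; omega

theorem suff (n p : ℕ) (hn : 2 ≤ n)
    (B : Fin (p + 1) → Matrix (Fin n) (Fin n) ℂ)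
    (hBinv : ∀ j, IsUnit (B j))
    (hdist : HasDistinctEigenvalues (B 0))
    (hdet : ∏ j, (B j).det = 1)
    (ha : 2 * n ^ 2 - 2 ≤ ∑ j, dd (B j)) (hb : n ≤ ∑ i ∈ Finset.univ.erase 0, rk (B i)) :
    ∃ M : Fin (p + 1) → Matrix (Fin n) (Fin n) ℂ,
        (∀ j, Sim (M j) (B j)) ∧ (List.ofFn M).prod = 1 ∧ TrivialCentralizer M := by
  obtain ⟨μ, hμ, hch⟩ := hdist
  have hsim := ds_diag hμ hch
  have hdet0 : (B 0).det = ∏ k, μ k := by rw [hsim.det, Matrix.det_diagonal]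
  have hd0 : (B 0).det ≠ 0 := ((Matrix.isUnit_iff_isUnit_det _).1 (hBinv 0)).ne_zero
  have hμ0 : ∀ k, μ k ≠ 0 := by
    intro k hk
    exact hd0 (by rw [hdet0]; exact Finset.prod_eq_zero (Finset.mem_univ k) hk)
  have hinj : Function.Injective fun k => (μ k)⁻¹ := fun a b h => hμ (inv_injective h)
  have herase : ∑ i ∈ Finset.univ.erase 0, rk (B i) = ∑ i : Fin p, rk (B i.succ) := by
    have := Finset.add_sum_erase Finset.univ (fun i => rk (B i)) (Finset.mem_univ 0)
    rw [Fin.sum_univ_succ] at this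
    omega
  obtain ⟨M, hM, hMc, hMT⟩ := full hn p (fun i => B i.succ) (fun i => rk (B i.succ)) (fun i => hBinv _)
    (fun i ν => rk_le _ _) (by rw [← herase]; exact hb) (by
      intro h3 hE
      have h1 := exc_dd hE
      have h2 := dd_diag μ
      rw [← dd_sim hsim] at h2
      rw [Fin.sum_univ_succ] at ha
      omega) (Finset.univ.image fun k => (μ k)⁻¹) (by
      rw [Finset.card_image_of_injective _ hinj, Finset.card_univ, Fintype.card_fin]) (by
      simp [hμ0]) (by
      rw [Finset.prod_image fun a _ b _ h => hinj h]
      rw [Fin.prod_univ_succ, hdet0] at hdet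
      rw [Finset.prod_inv_distrib]
      exact inv_eq_of_mul_eq_one_right hdet)
  rw [Finset.prod_image fun a _ b _ h => hinj h] at hMc
  obtain ⟨S, S', h1, h2, h3⟩ := ds_diag hinj hMc
  refine ⟨Fin.cons (S * diagonal μ * S') M, ?_, ?_, ?_⟩
  · intro j
    refine Fin.cases ?_ (fun i => ?_) j
    · rw [Fin.cons_zero]
      exact Sim.trans ⟨S, S', h1, h2, rfl⟩ hsim.symm
    · rw [Fin.cons_succ]; exact hM i
  · rw [List.ofFn_succ, List.prod_cons]
    simp only [Fin.cons_zero, Fin.cons_succ]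
    rw [h3]
    calc _ = S * (diagonal μ * (S' * S) * diagonal fun k => (μ k)⁻¹) * S' := by simp only [Matrix.mul_assoc]
      _ = 1 := by
        rw [h2, Matrix.mul_one, Matrix.diagonal_mul_diagonal]
        have : (fun i => μ i * (μ i)⁻¹) = fun _ => (1 : ℂ) := by
          ext i; exact mul_inv_cancel₀ (hμ0 i)
        rw [this, Matrix.diagonal_one, Matrix.mul_one, h1]
  · intro Z hZ
    exact hMT Z fun j => by simpa using hZ j.succ

theorem comm_of_others {n : ℕ} {Z : Matrix (Fin n) (Fin n) ℂ} :
    ∀ (k : ℕ) (M : Fin k → Matrix (Fin n) (Fin n) ℂ), (∀ i, IsUnit (M i)) → ∀ j, (∀ i, i ≠ j → Z * M i = M i * Z) →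
      Z * (List.ofFn M).prod = (List.ofFn M).prod * Z → Z * M j = M j * Z := by
  intro k
  induction k with
  | zero => intro M _ j; exact j.elim0
  | succ k ih =>
    intro M hu j hj hp
    rw [List.ofFn_succ, List.prod_cons] at hp
    have hQu := ofFn_unit k (fun i => M i.succ) fun i => hu _
    revert hj
    refine Fin.cases ?_ (fun j => ?_) j
    · intro hj
      have hQ := ofFn_comm k (fun i => M i.succ) fun i => hj _ (Fin.succ_ne_zero i)
      apply hQu.mul_right_cancel
      rw [mul_assoc, hp, mul_assoc, ← hQ, mul_assoc]
    · intro hj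
      refine ih (fun i => M i.succ) (fun i => hu _) j (fun i hi => hj _ fun h => hi (Fin.succ_injective _ h)) ?_
      apply (hu 0).mul_left_cancel
      rw [← mul_assoc, ← hj 0 (Fin.succ_ne_zero j).symm, mul_assoc, hp, mul_assoc]

theorem ker_inter {n : ℕ} {ι : Type} (J : Finset ι) (N : ι → Matrix (Fin n) (Fin n) ℂ)
    (h : ∑ i ∈ J, (N i).rank < n) : ∃ v, v ≠ 0 ∧ ∀ i ∈ J, N i *ᵥ v = 0 := by
  classical
  have key : ∃ W : Submodule ℂ (Fin n → ℂ), (∀ v ∈ W, ∀ i ∈ J, N i *ᵥ v = 0) ∧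
      n ≤ Module.finrank ℂ W + ∑ i ∈ J, (N i).rank := by
    clear h
    induction J using Finset.induction_on with
    | empty => exact ⟨⊤, by simp, by simp⟩
    | insert a J ha ih =>
      obtain ⟨W, h1, h2⟩ := ih
      refine ⟨W ⊓ LinearMap.ker (N a).mulVecLin, ?_, ?_⟩
      · intro v hv i hi
        rcases Finset.mem_insert.1 hi with rfl | hi
        · exact hv.2
        · exact h1 v hv.1 i hi
      · rw [Finset.sum_insert ha]
        have h3 := Submodule.finrank_sup_add_finrank_inf_eq W (LinearMap.ker (N a).mulVecLin)
        have h4 := Submodule.finrank_le (W ⊔ LinearMap.ker (N a).mulVecLin)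
        have h5 := LinearMap.finrank_range_add_finrank_ker (N a).mulVecLin
        rw [Module.finrank_fintype_fun_eq_card, Fintype.card_fin] at h4 h5
        rw [Matrix.rank]
        omega
  obtain ⟨W, h1, h2⟩ := key
  have : W ≠ ⊥ := by
    rintro rfl
    rw [finrank_bot] at h2; omega
  obtain ⟨v, hv, hv0⟩ := Submodule.exists_mem_ne_zero_of_ne_bot this
  exact ⟨v, hv0, h1 v hv⟩

theorem nec_beta {n k : ℕ} (hn : 2 ≤ n) (M : Fin k → Matrix (Fin n) (Fin n) ℂ) (hu : ∀ i, IsUnit (M i))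
    (hp : (List.ofFn M).prod = 1) (hT : TrivialCentralizer M) (j : Fin k) :
    n ≤ ∑ i ∈ Finset.univ.erase j, rk (M i) := by
  by_contra hlt
  push Not at hlt
  choose l hl using fun i => rk_att (M i)
  obtain ⟨v, hv0, hv⟩ := ker_inter (Finset.univ.erase j) (fun i => M i - l i • (1 : Matrix (Fin n) (Fin n) ℂ))
    (by simp only [hl]; exact hlt)
  obtain ⟨w, hw0, hw⟩ := ker_inter (Finset.univ.erase j) (fun i => (M i - l i • (1 : Matrix (Fin n) (Fin n) ℂ))ᵀ)
    (by simp only [Matrix.rank_transpose, hl]; exact hlt)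
  have hc : ∀ i, i ≠ j → vecMulVec v w * M i = M i * vecMulVec v w := by
    intro i hi
    have h1 := hv i (Finset.mem_erase.2 ⟨hi, Finset.mem_univ _⟩)
    have h2 := hw i (Finset.mem_erase.2 ⟨hi, Finset.mem_univ _⟩)
    have h1' : M i *ᵥ v = l i • v := by
      rw [Matrix.sub_mulVec, Matrix.smul_mulVec, Matrix.one_mulVec, sub_eq_zero] at h1; exact h1
    have h2' : w ᵥ* M i = l i • w := by
      rw [Matrix.mulVec_transpose, Matrix.vecMul_sub, Matrix.vecMul_smul, Matrix.vecMul_one, sub_eq_zero] at h2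
      exact h2
    rw [Matrix.vecMulVec_mul, Matrix.mul_vecMulVec, h1', h2', Matrix.smul_vecMulVec, Matrix.vecMulVec_smul]
  obtain ⟨c, hZ⟩ := hT (vecMulVec v w) fun i => by
    by_cases hi : i = j
    · rw [hi]
      exact comm_of_others k M hu j hc (by rw [hp]; simp)
    · exact hc i hi
  have hent : ∀ a b, v a * w b = c * (1 : Matrix (Fin n) (Fin n) ℂ) a b := by
    intro a b
    have := congrFun (congrFun hZ a) b
    simpa [Matrix.vecMulVec_apply] using this
  obtain ⟨a, ha⟩ := Function.ne_iff.1 hv0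
  obtain ⟨b, hb⟩ := Function.ne_iff.1 hw0
  have hab : v a * w b ≠ 0 := mul_ne_zero ha hb
  have e : a = b := by
    by_contra hne
    exact hab (by rw [hent, Matrix.one_apply_ne hne, mul_zero])
  subst e
  have hc0 : c ≠ 0 := by
    intro h
    exact hab (by rw [hent, h, zero_mul])
  have hnt : Nontrivial (Fin n) := Fin.nontrivial_iff_two_le.2 hn
  obtain ⟨d, hd⟩ := exists_ne a
  have h1 := hent d d
  have h2 := hent a d
  rw [Matrix.one_apply_eq, mul_one] at h1
  rw [Matrix.one_apply_ne hd.symm, mul_zero] at h2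
  rcases mul_eq_zero.1 h2 with h | h
  · exact ha h
  · rw [h, mul_zero] at h1; exact hc0 h1.symm

noncomputable def sig {n : ℕ} : ∀ k : ℕ, (Fin k → Matrix (Fin n) (Fin n) ℂ) →
    ((Fin k → Matrix (Fin n) (Fin n) ℂ) →ₗ[ℂ] Matrix (Fin n) (Fin n) ℂ)
  | 0, _ => 0
  | k + 1, M =>
    (LinearMap.mulRight ℂ (List.ofFn fun i : Fin k => M i.succ).prod).comp (LinearMap.proj 0) +
      (LinearMap.mulLeft ℂ (M 0)).comp
        ((sig k fun i => M i.succ).comp (LinearMap.funLeft ℂ (Matrix (Fin n) (Fin n) ℂ) Fin.succ))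

theorem sig_succ {n k : ℕ} (M Y : Fin (k + 1) → Matrix (Fin n) (Fin n) ℂ) :
    sig (k + 1) M Y = Y 0 * (List.ofFn fun i : Fin k => M i.succ).prod +
      M 0 * sig k (fun i => M i.succ) (fun i => Y i.succ) := rfl

theorem sig_delta {n : ℕ} (X : Matrix (Fin n) (Fin n) ℂ) : ∀ (k : ℕ) (M : Fin k → Matrix (Fin n) (Fin n) ℂ),
    sig k M (fun j => M j * X - X * M j) = (List.ofFn M).prod * X - X * (List.ofFn M).prod := by
  intro k
  induction k with
  | zero => intro M; simp [sig]
  | succ k ih =>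
    intro M
    rw [sig_succ, ih, List.ofFn_succ, List.prod_cons]
    simp only [mul_sub, sub_mul, mul_assoc]
    abel

theorem sig_dual {n : ℕ} : ∀ (k : ℕ) (M : Fin k → Matrix (Fin n) (Fin n) ℂ) (W : Matrix (Fin n) (Fin n) ℂ),
    (∀ Y : Fin k → Matrix (Fin n) (Fin n) ℂ, (∀ j, Y j ∈ LinearMap.range (sylv (M j) (M j))) →
      (W * sig k M Y).trace = 0) → ∀ j, ((List.ofFn M).prod * W) * M j = M j * ((List.ofFn M).prod * W) := by
  intro k
  induction k with
  | zero => intro M W _ j; exact j.elim0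
  | succ k ih =>
    intro M W h
    rw [List.ofFn_succ, List.prod_cons]
    set Q := (List.ofFn fun i : Fin k => M i.succ).prod with hQ
    have h0 : Q * W * M 0 = M 0 * (Q * W) := by
      rw [← sub_eq_zero]
      apply Matrix.ext_iff_trace_mul_right.2
      intro X
      have h1 := h (Fin.cons (M 0 * X - X * M 0) 0) (by
        intro j
        refine Fin.cases ?_ (fun i => ?_) j
        · exact ⟨X, rfl⟩
        · rw [Fin.cons_succ]; exact Submodule.zero_mem _)
      rw [sig_succ] at h1
      simp only [Fin.cons_zero, Fin.cons_succ] at h1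
      have e0 : (fun i : Fin k => (0 : Fin k → Matrix (Fin n) (Fin n) ℂ) i) = 0 := rfl
      rw [e0, map_zero, mul_zero, add_zero, ← hQ] at h1
      rw [zero_mul, Matrix.trace_zero, ← h1, sub_mul, mul_assoc (M 0), Matrix.trace_sub, sub_mul, mul_sub, Matrix.trace_sub]
      congr 1
      · rw [← mul_assoc W, Matrix.trace_mul_comm (W * _) Q]; simp only [mul_assoc]
      · rw [Matrix.trace_mul_comm (M 0), ← mul_assoc W, Matrix.trace_mul_comm (W * _) Q]; simp only [mul_assoc]
    have hs : ∀ j : Fin k, (Q * (W * M 0)) * M j.succ = M j.succ * (Q * (W * M 0)) := by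
      refine ih (fun i => M i.succ) (W * M 0) ?_
      intro Y hY
      have h1 := h (Fin.cons 0 Y) (by
        intro j
        refine Fin.cases ?_ (fun i => ?_) j
        · exact Submodule.zero_mem _
        · rw [Fin.cons_succ]; exact hY i)
      rw [sig_succ] at h1
      simp only [Fin.cons_zero, Fin.cons_succ] at h1
      rw [zero_mul, zero_add, ← mul_assoc] at h1
      exact h1
    intro j
    refine Fin.cases ?_ (fun i => ?_) j
    · rw [mul_assoc (M 0) Q W, mul_assoc (M 0), h0]
    · rw [mul_assoc (M 0) Q W, ← h0, mul_assoc Q W]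
      exact hs i

theorem finrank_scal {n : ℕ} {U : Submodule ℂ (Matrix (Fin n) (Fin n) ℂ)}
    (h : ∀ Z ∈ U, ∃ c : ℂ, Z = c • (1 : Matrix (Fin n) (Fin n) ℂ)) : Module.finrank ℂ U ≤ 1 := by
  have h1 : U ≤ Submodule.span ℂ {(1 : Matrix (Fin n) (Fin n) ℂ)} := by
    intro Z hZ
    obtain ⟨c, rfl⟩ := h Z hZ
    exact Submodule.smul_mem _ _ (Submodule.mem_span_singleton_self _)
  refine (Submodule.finrank_mono h1).trans ((finrank_span_le_card _).trans ?_)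
  simp

theorem count_aux {E F G D : Type} [AddCommGroup E] [Module ℂ E] [FiniteDimensional ℂ E] [AddCommGroup F] [Module ℂ F]
    [FiniteDimensional ℂ F] [AddCommGroup G] [Module ℂ G] [AddCommGroup D] [Module ℂ D] [FiniteDimensional ℂ D]
    (δ : E →ₗ[ℂ] F) (ψ : F →ₗ[ℂ] G) (Φ : E →ₗ[ℂ] D)
    (h0 : ∀ x, ψ (δ x) = 0) (h1 : Module.finrank ℂ (LinearMap.ker δ) ≤ 1) (h2 : Module.finrank ℂ (LinearMap.ker Φ) ≤ 1)
    (h3 : Module.finrank ℂ D = Module.finrank ℂ (LinearMap.range ψ)) :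
    2 * Module.finrank ℂ E ≤ Module.finrank ℂ F + 2 := by
  have a1 := LinearMap.finrank_range_add_finrank_ker δ
  have a2 := LinearMap.finrank_range_add_finrank_ker ψ
  have a3 := LinearMap.finrank_range_add_finrank_ker Φ
  have a4 := Submodule.finrank_le (LinearMap.range Φ)
  have a5 : LinearMap.range δ ≤ LinearMap.ker ψ := by
    rintro _ ⟨x, rfl⟩; exact h0 x
  have a6 := Submodule.finrank_mono a5
  omega

theorem nec_alpha {n k : ℕ} (M : Fin k → Matrix (Fin n) (Fin n) ℂ)
    (hp : (List.ofFn M).prod = 1) (hT : TrivialCentralizer M) : 2 * n ^ 2 ≤ ∑ j, dd (M j) + 2 := by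
  let δ : Matrix (Fin n) (Fin n) ℂ →ₗ[ℂ] (∀ j, LinearMap.range (sylv (M j) (M j))) :=
    LinearMap.pi fun j => (sylv (M j) (M j)).rangeRestrict
  let ψ : (∀ j, LinearMap.range (sylv (M j) (M j))) →ₗ[ℂ] Matrix (Fin n) (Fin n) ℂ :=
    (sig k M).comp (LinearMap.pi fun j => (Submodule.subtype _).comp (LinearMap.proj j))
  let Φ : Matrix (Fin n) (Fin n) ℂ →ₗ[ℂ] Module.Dual ℂ (LinearMap.range ψ) :=
    { toFun := fun W => ((Matrix.traceLinearMap (Fin n) ℂ ℂ).comp (LinearMap.mulLeft ℂ W)).comp (Submodule.subtype _)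
      map_add' := fun W W' => LinearMap.ext fun v => by
        change ((W + W') * v.1).trace = (W * v.1).trace + (W' * v.1).trace
        rw [add_mul, Matrix.trace_add]
      map_smul' := fun c W => LinearMap.ext fun v => by
        change ((c • W) * v.1).trace = c • (W * v.1).trace
        rw [Matrix.smul_mul, Matrix.trace_smul] }
  have key := count_aux δ ψ Φ ?_ ?_ ?_ Subspace.dual_finrank_eq
  · rw [Module.finrank_matrix, Fintype.card_fin, Module.finrank_self, Module.finrank_pi_fintype] at key
    simp only [dd_eq_rank] at key
    have : n ^ 2 = n * n * 1 := by ring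
    omega
  · intro X
    change sig k M (fun j => M j * X - X * M j) = 0
    rw [sig_delta, hp]; simp
  · apply finrank_scal
    intro Z hZ
    apply hT
    intro j
    have h1 := congrArg Subtype.val (congrFun (LinearMap.mem_ker.1 hZ) j)
    have h2 : M j * Z - Z * M j = 0 := h1
    exact (sub_eq_zero.1 h2).symm
  · apply finrank_scal
    intro W hW
    apply hT
    have := sig_dual k M W (fun Y hY => by
      have h1 := LinearMap.congr_fun (LinearMap.mem_ker.1 hW) ⟨ψ fun j => ⟨Y j, hY j⟩, ⟨_, rfl⟩⟩
      exact h1)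
    intro j
    simpa [hp] using this j

theorem main_final (n p : ℕ) (hn : 2 ≤ n)
    (B : Fin (p + 1) → Matrix (Fin n) (Fin n) ℂ)
    (hBinv : ∀ j, IsUnit (B j))
    (hdist : HasDistinctEigenvalues (B 0))
    (hdet : ∏ j, (B j).det = 1) :
    (∃ M : Fin (p + 1) → Matrix (Fin n) (Fin n) ℂ,
        (∀ j, SameClass (M j) (B j)) ∧ (List.ofFn M).prod = 1 ∧ TrivialCentralizer M) ↔
      ((2 * n ^ 2 - 2 ≤ ∑ j, dd (B j)) ∧
        ∀ j, n ≤ ∑ i ∈ Finset.univ.erase j, rk (B i)) := by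
  simp only [sameClass_iff]
  constructor
  · rintro ⟨M, hM, hp, hT⟩
    constructor
    · have := nec_alpha M hp hT
      rw [Finset.sum_congr rfl fun j _ => dd_sim (hM j)] at this
      omega
    · intro j
      have := nec_beta hn M (fun i => (hM i).isUnit (hBinv i)) hp hT j
      rwa [Finset.sum_congr rfl fun j _ => rk_sim (hM j)] at this
  · rintro ⟨ha, hb⟩
    exact suff n p hn B hBinv hdist hdet ha (hb 0)

end own

/-- Weak DSP, multiplicative version: conditions `(α_n)` and `(β_n)` are necessary and
sufficient for the existence of a tuple with product `I` and trivial centralizer. -/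
theorem stmt8 (n p : ℕ) (hn : 2 ≤ n) (hp : 1 ≤ p)
    (B : Fin (p + 1) → Matrix (Fin n) (Fin n) ℂ)
    (hBinv : ∀ j, IsUnit (B j))
    (hdist : HasDistinctEigenvalues (B 0))
    (hdet : ∏ j, (B j).det = 1) :
    (∃ M : Fin (p + 1) → Matrix (Fin n) (Fin n) ℂ,
        (∀ j, SameClass (M j) (B j)) ∧ (List.ofFn M).prod = 1 ∧ TrivialCentralizer M) ↔
      ((2 * n ^ 2 - 2 ≤ ∑ j, dd (B j)) ∧
        ∀ j, n ≤ ∑ i ∈ Finset.univ.erase j, rk (B i)) := by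
  exact main_final n p hn B hBinv hdist hdet
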